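/- arXiv:2506.17745 — 2 statements merged into one kernel-verified Lean document; each statement's English description precedes it below -/
import Mathlib

section
/- Let p ≥ 1 be an integer and let μ and ν be Borel probability measures supported on the closed unit ball {|x| ≤ 1} of ℝ^d, having equal mixed moments of all orders up to p−1. Then there is an absolute constant c > 0 such that ζ_p(μ,ν) ≤ (c d)^p · (sup_{|θ|=1} ζ_p(μ_θ, ν_θ))^β with β = 2 / (2 + d/p). -/
open MeasureTheory
open scoped RealInnerProductSpace ENNReal NNReal

noncomputable section


/-- The list of coordinate directions encoded by a multi-index `α` on `ℝ^d`:
the direction `i` is repeated `α i` times, so the list has length `|α| = ∑ i, α i`. -/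
def multiIndexDirs {d : ℕ} (α : Fin d → ℕ) : List (Fin d) :=
  (List.finRange d).flatMap fun i => List.replicate (α i) i

/-- `D^α u (x)`: the partial derivative of `u` at `x` corresponding to the multi-index `α`
(of order `|α| = ∑ i, α i`), as an iterated derivative in the coordinate directions. -/
def mderiv {d : ℕ} (α : Fin d → ℕ) (u : EuclideanSpace ℝ (Fin d) → ℝ)
    (x : EuclideanSpace ℝ (Fin d)) : ℝ :=
  iteratedFDeriv ℝ (multiIndexDirs α).length u x
    (fun k => EuclideanSpace.single ((multiIndexDirs α).get k) 1)


/-- The Zolotarev distance of order `p` between (probability) measures on `ℝ^d`: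
the supremum of `|∫ u dμ - ∫ u dν|` over all `C^∞`-smooth `u : ℝ^d → ℝ` whose
partial derivatives of order `p` are bounded by `1` in absolute value. -/
def zolotarevDist {d : ℕ} (p : ℕ) (μ ν : Measure (EuclideanSpace ℝ (Fin d))) : ℝ :=
  sSup { z | ∃ u : EuclideanSpace ℝ (Fin d) → ℝ, ContDiff ℝ (⊤ : ℕ∞) u ∧
    (∀ α : Fin d → ℕ, (∑ i, α i) = p → ∀ x, |mderiv α u x| ≤ 1) ∧
    z = |(∫ x, u x ∂μ) - ∫ x, u x ∂ν| }


/-- The Zolotarev distance of order `p` between (probability) measures on `ℝ`: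
the supremum of `|∫ v dμ - ∫ v dν|` over all `p`-times differentiable `v : ℝ → ℝ`
with `|v^{(p)}| ≤ 1` everywhere. -/
def zolotarevDistR (p : ℕ) (μ ν : Measure ℝ) : ℝ :=
  sSup { z | ∃ v : ℝ → ℝ, ContDiff ℝ (p : ℕ∞) v ∧ (∀ t, |iteratedDeriv p v t| ≤ 1) ∧
    z = |(∫ x, v x ∂μ) - ∫ x, v x ∂ν| }



/-- iterated derivative along a list of vectors -/
def lder {E : Type*} [NormedAddCommGroup E] [NormedSpace ℝ E] (u : E → ℝ) (l : List E) (x : E) : ℝ :=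
  iteratedFDeriv ℝ l.length u x l.get

theorem lder_cons {E : Type*} [NormedAddCommGroup E] [NormedSpace ℝ E] {u : E → ℝ}
    (hu : ContDiff ℝ (⊤ : ℕ∞) u) (v : E) (l : List E) (x : E) :
    lder u (v :: l) x = fderiv ℝ (lder u l) x v := by
  unfold lder
  have h : DifferentiableAt ℝ (iteratedFDeriv ℝ l.length u) x :=
    (hu.differentiable_iteratedFDeriv (by exact_mod_cast ENat.natCast_lt_top _)) x
  have := fderiv_continuousMultilinear_apply_const_apply h l.get v
  rw [this]
  exact iteratedFDeriv_succ_apply_left (𝕜 := ℝ) (n := l.length) (f := u) (x := x) (v :: l).get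

theorem lder_contDiff {E : Type*} [NormedAddCommGroup E] [NormedSpace ℝ E] {u : E → ℝ}
    (hu : ContDiff ℝ (⊤ : ℕ∞) u) (l : List E) : ContDiff ℝ (⊤ : ℕ∞) (lder u l) := by
  unfold lder
  have h : ContDiff ℝ (⊤ : ℕ∞) (iteratedFDeriv ℝ l.length u) :=
    hu.iteratedFDeriv_right (by exact_mod_cast le_top)
  exact (ContinuousMultilinearMap.apply ℝ (fun _ : Fin l.length => E) ℝ l.get).contDiff.comp h

theorem lder_perm {E : Type*} [NormedAddCommGroup E] [NormedSpace ℝ E] {u : E → ℝ}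
    (hu : ContDiff ℝ (⊤ : ℕ∞) u) {l l' : List E} (h : l.Perm l') : lder u l = lder u l' := by
  induction h with
  | nil => rfl
  | cons v _ ih => funext x; rw [lder_cons hu, lder_cons hu, ih]
  | swap a b l =>
    funext x
    have e : ∀ v, lder u (v :: l) = fun y => fderiv ℝ (lder u l) y v := fun v => by
      funext y; rw [lder_cons hu]
    rw [lder_cons hu, lder_cons hu, e, e]
    have hs : ContDiffAt ℝ (⊤ : ℕ∞) (lder u l) x := (lder_contDiff hu l).contDiffAt
    have hsym := hs.isSymmSndFDerivAt (by simp only [minSmoothness_of_isRCLikeNormedField]; exact WithTop.coe_le_coe.2 (le_top : (2:ℕ∞) ≤ ⊤))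
    have hd : DifferentiableAt ℝ (fderiv ℝ (lder u l)) x :=
      (((lder_contDiff hu l).fderiv_right (m := 1) (by norm_cast)).differentiable (by simp)) x
    rw [fderiv_clm_apply hd (by fun_prop), fderiv_clm_apply hd (by fun_prop)]
    simpa using hsym b a
  | trans _ _ h1 h2 => exact h1.trans h2

theorem iteratedFDeriv_eq_lder {E : Type*} [NormedAddCommGroup E] [NormedSpace ℝ E] (u : E → ℝ)
    {n : ℕ} (v : Fin n → E) (x : E) : iteratedFDeriv ℝ n u x v = lder u (List.ofFn v) x := by
  unfold lder
  have : ∀ (m : ℕ) (h : m = n) (w : Fin m → E) (hw : ∀ k, w k = v (Fin.cast h k)), 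
      iteratedFDeriv ℝ n u x v = iteratedFDeriv ℝ m u x w := by
    rintro m rfl w hw
    congr 1; funext k; rw [hw]; rfl
  apply this _ (by simp)
  intro k; simp; rfl

theorem iteratedFDeriv_symm {E : Type*} [NormedAddCommGroup E] [NormedSpace ℝ E] {u : E → ℝ}
    (hu : ContDiff ℝ (⊤ : ℕ∞) u) {n : ℕ} (v : Fin n → E) (s : Equiv.Perm (Fin n)) (x : E) :
    iteratedFDeriv ℝ n u x (fun i => v (s i)) = iteratedFDeriv ℝ n u x v := by
  rw [iteratedFDeriv_eq_lder, iteratedFDeriv_eq_lder]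
  exact congrFun (lder_perm hu (Equiv.Perm.ofFn_comp_perm s v)) x

/-- the Taylor series -/
def tser {E : Type*} [NormedAddCommGroup E] [NormedSpace ℝ E] (u : E → ℝ) (p : ℕ) :
    FormalMultilinearSeries ℝ E ℝ :=
  fun k => if k < p then ((k.factorial : ℝ)⁻¹) • iteratedFDeriv ℝ k u 0 else 0

def tpol {E : Type*} [NormedAddCommGroup E] [NormedSpace ℝ E] (u : E → ℝ) (p : ℕ) (x : E) : ℝ :=
  ∑ k ∈ Finset.range p, ((k.factorial : ℝ)⁻¹) * iteratedFDeriv ℝ k u 0 (fun _ => x)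

theorem tpol_fps {E : Type*} [NormedAddCommGroup E] [NormedSpace ℝ E] (u : E → ℝ) (p : ℕ) :
    HasFiniteFPowerSeriesOnBall (tpol u p) (tser u p) 0 p ⊤ := by
  apply HasFiniteFPowerSeriesOnBall.mk'
  · intro m hm
    simp [tser, not_lt.2 hm]
  · simp
  · intro y _
    simp only [tpol, zero_add]
    apply Finset.sum_congr rfl
    intro k hk
    simp [tser, Finset.mem_range.1 hk]

theorem tpol_contDiff {E : Type*} [NormedAddCommGroup E] [NormedSpace ℝ E] (u : E → ℝ) (p : ℕ) :
    ContDiff ℝ (⊤ : ℕ∞) (tpol u p) := by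
  unfold tpol
  apply ContDiff.sum
  intro k _
  apply contDiff_const.mul
  exact (iteratedFDeriv ℝ k u 0).contDiff.comp (contDiff_pi.2 fun _ => contDiff_id)

theorem tpol_der_zero {E : Type*} [NormedAddCommGroup E] [NormedSpace ℝ E] {u : E → ℝ}
    (hu : ContDiff ℝ (⊤ : ℕ∞) u) (p k : ℕ) (hk : k < p) :
    iteratedFDeriv ℝ k (tpol u p) 0 = iteratedFDeriv ℝ k u 0 := by
  ext v
  rw [(tpol_fps u p).toHasFPowerSeriesOnBall.iteratedFDeriv_eq_sum_of_completeSpace]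
  have : ∀ s : Equiv.Perm (Fin k), (tser u p k) (fun i => v (s i)) =
      (k.factorial : ℝ)⁻¹ * iteratedFDeriv ℝ k u 0 v := by
    intro s
    simp only [tser, hk, if_true, smul_apply, smul_eq_mul, iteratedFDeriv_symm hu]
  simp only [this]
  simp [Fintype.card_perm]
  have : (k.factorial : ℝ) ≠ 0 := by positivity
  field_simp

theorem tpol_der_top {E : Type*} [NormedAddCommGroup E] [NormedSpace ℝ E] (u : E → ℝ)
    (p : ℕ) (x : E) : iteratedFDeriv ℝ p (tpol u p) x = 0 := by
  ext v
  have h := (tpol_fps u p).changeOrigin (y := x) (by simp)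
  rw [zero_add] at h
  rw [h.toHasFPowerSeriesOnBall.iteratedFDeriv_eq_sum_of_completeSpace]
  simp [h.finite p le_rfl]

theorem taylor_bound {E : Type*} [NormedAddCommGroup E] [NormedSpace ℝ E] {u : E → ℝ}
    (hu : ContDiff ℝ (⊤ : ℕ∞) u) (p : ℕ) (K : ℝ) (hK : ∀ x, ‖iteratedFDeriv ℝ p u x‖ ≤ K) (k : ℕ)
    (hk : k ≤ p) (x : E) :
    ‖iteratedFDeriv ℝ (p - k) (fun y => u y - tpol u p y) x‖ ≤ K * ‖x‖ ^ k / k.factorial := by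
  have hsub : ∀ j y, iteratedFDeriv ℝ j (fun y => u y - tpol u p y) y =
      iteratedFDeriv ℝ j u y - iteratedFDeriv ℝ j (tpol u p) y := by
    intro j y
    exact iteratedFDeriv_sub_apply (hu.of_le (by exact_mod_cast le_top)).contDiffAt
      ((tpol_contDiff u p).of_le (by exact_mod_cast le_top)).contDiffAt
  have hrc : ContDiff ℝ (⊤ : ℕ∞) (fun y => u y - tpol u p y) := hu.sub (tpol_contDiff u p)
  induction k generalizing x with
  | zero => simpa [hsub, tpol_der_top] using hK x
  | succ k ih =>
    have hK0 : 0 ≤ K := (norm_nonneg _).trans (hK 0)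
    set r := fun y => u y - tpol u p y with hr
    obtain ⟨j, hj⟩ : ∃ j, p = j + (k + 1) := ⟨p - (k+1), by omega⟩
    have e1 : p - (k + 1) = j := by omega
    have e2 : p - k = j + 1 := by omega
    rw [e1]
    have ih' : ∀ x, ‖fderiv ℝ (iteratedFDeriv ℝ j r) x‖ ≤ K * ‖x‖ ^ k / k.factorial := by
      intro x
      rw [norm_fderiv_iteratedFDeriv, ← e2]
      exact ih (by omega) x
    have hd : Differentiable ℝ (iteratedFDeriv ℝ j r) :=
      hrc.differentiable_iteratedFDeriv (by exact_mod_cast ENat.natCast_lt_top _)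
    have h0 : iteratedFDeriv ℝ j r 0 = 0 := by
      rw [hsub, tpol_der_zero hu _ _ (by omega), sub_self]
    -- along the ray
    have hray : ∀ t : ℝ, HasDerivAt (fun t : ℝ => iteratedFDeriv ℝ j r (t • x))
        (fderiv ℝ (iteratedFDeriv ℝ j r) (t • x) x) t := by
      intro t
      have : HasDerivAt (fun t : ℝ => t • x) x t := by
        simpa using (hasDerivAt_id t).smul_const x
      exact (hd (t • x)).hasFDerivAt.comp_hasDerivAt t this
    have := image_norm_le_of_norm_deriv_right_le_deriv_boundary (a := 0) (b := 1)
      (f := fun t : ℝ => iteratedFDeriv ℝ j r (t • x))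
      (f' := fun t => fderiv ℝ (iteratedFDeriv ℝ j r) (t • x) x)
      (B := fun t => K * ‖x‖ ^ (k+1) / (k+1).factorial * t ^ (k+1))
      (B' := fun t => K * ‖x‖ ^ (k+1) / k.factorial * t ^ k)
      (fun t _ => (hray t).continuousAt.continuousWithinAt)
      (fun t _ => (hray t).hasDerivWithinAt)
      (by simp [h0]) 
      (fun t => by
        have := ((hasDerivAt_pow (k+1) t).const_mul (K * ‖x‖ ^ (k+1) / (k+1).factorial))
        refine this.congr_deriv ?_
        rw [Nat.factorial_succ]
        have : (k.factorial : ℝ) ≠ 0 := by positivity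
        push_cast
        field_simp)
      (fun t ht => by
        refine (ContinuousLinearMap.le_opNorm _ _).trans ?_
        refine (mul_le_mul_of_nonneg_right (ih' _) (norm_nonneg _)).trans (le_of_eq ?_)
        rw [norm_smul, Real.norm_of_nonneg ht.1]
        ring)
    have h1 := this (x := 1) (by simp)
    simpa using h1


theorem steklov_step {h : ℝ} (hh : 0 < h) {a b : ℝ} {j : ℕ} {f : ℝ → ℝ}
    (hf : ContDiff ℝ (⊤ : ℕ∞) f) (h1 : ∀ s, |s| ≤ a → f s = 1) (h0 : ∀ s, b ≤ |s| → f s = 0)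
    (hb : ∀ k ≤ j, ∀ s, |iteratedDeriv k f s| ≤ (1 / h) ^ k) :
    ∃ g : ℝ → ℝ, ContDiff ℝ (⊤ : ℕ∞) g ∧ (∀ s, |s| ≤ a - h → g s = 1) ∧
      (∀ s, b + h ≤ |s| → g s = 0) ∧
      ∀ k ≤ j + 1, ∀ s, |iteratedDeriv k g s| ≤ (1 / h) ^ k := by
  have hc := hf.continuous
  set F : ℝ → ℝ := fun s => ∫ t in (0:ℝ)..s, f t with hF
  have hFd : ∀ s, HasDerivAt F (f s) s := fun s =>
    intervalIntegral.integral_hasDerivAt_right (hc.intervalIntegrable _ _)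
      (hc.stronglyMeasurableAtFilter _ _) hc.continuousAt
  have hFs : ContDiff ℝ (⊤ : ℕ∞) F := by
    rw [contDiff_infty_iff_deriv]
    refine ⟨fun s => (hFd s).differentiableAt, ?_⟩
    rwa [show deriv F = f from funext fun s => (hFd s).deriv]
  set g : ℝ → ℝ := fun s => (1 / (2 * h)) * (F (s + h) - F (s - h)) with hg
  have hgi : ∀ s, g s = (1 / (2 * h)) * ∫ t in (s - h)..(s + h), f t := by
    intro s
    rw [hg]
    simp only [hF]
    rw [intervalIntegral.integral_interval_sub_left (hc.intervalIntegrable _ _)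
      (hc.intervalIntegrable _ _)]
  have hgs : ContDiff ℝ (⊤ : ℕ∞) g := by
    apply contDiff_const.mul
    exact (hFs.comp (contDiff_id.add contDiff_const)).sub (hFs.comp (contDiff_id.sub contDiff_const))
  have hgd : deriv g = fun s => (1 / (2 * h)) * (f (s + h) - f (s - h)) := by
    funext s
    have e1 : HasDerivAt (fun s => F (s + h)) (f (s + h)) s := (hFd (s + h)).comp_add_const s h
    have e2 : HasDerivAt (fun s => F (s - h)) (f (s - h)) s := (hFd (s - h)).comp_sub_const s h
    exact ((e1.sub e2).const_mul _).deriv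
  refine ⟨g, hgs, ?_, ?_, ?_⟩
  · intro s hs
    rw [hgi, intervalIntegral.integral_congr (g := fun _ => 1)]
    · simp; field_simp; ring
    · intro t ht
      rw [Set.uIcc_of_le (by linarith)] at ht
      apply h1
      rw [abs_le] at hs ⊢
      constructor <;> linarith [ht.1, ht.2]
  · intro s hs
    rw [hgi, intervalIntegral.integral_congr (g := fun _ => 0)]
    · simp
    · intro t ht
      rw [Set.uIcc_of_le (by linarith)] at ht
      apply h0
      rw [le_abs] at hs ⊢
      rcases hs with hs | hs
      · left; linarith [ht.1]
      · right; linarith [ht.2]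
  · intro k hk s
    cases k with
    | zero =>
      simp only [iteratedDeriv_zero, pow_zero]
      have := intervalIntegral.norm_integral_le_of_norm_le_const (a := s - h) (b := s + h)
        (f := f) (C := 1) (fun t _ => by simpa using hb 0 (Nat.zero_le _) t)
      rw [hgi, abs_mul, abs_of_pos (by positivity)]
      rw [Real.norm_eq_abs, show s + h - (s - h) = 2 * h by ring, abs_of_pos (a := 2 * h) (by positivity)] at this
      calc _ ≤ 1 / (2 * h) * (1 * (2 * h)) := by gcongr
        _ = 1 := by field_simp
    | succ k =>
      rw [iteratedDeriv_succ', hgd]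
      have hk' : k ≤ j := by omega
      have : iteratedDeriv k (fun s => (1 / (2 * h)) * (f (s + h) - f (s - h))) s =
          (1 / (2 * h)) * (iteratedDeriv k f (s + h) - iteratedDeriv k f (s - h)) := by
        have hfk : ContDiff ℝ k f := hf.of_le (by exact_mod_cast le_top)
        have c1 : ContDiff ℝ k (fun s => f (s + h)) := hfk.comp (contDiff_id.add contDiff_const)
        have c2 : ContDiff ℝ k (fun s => f (s - h)) := hfk.comp (contDiff_id.sub contDiff_const)
        rw [iteratedDeriv_const_mul_field]
        rw [show (fun s => f (s + h) - f (s - h)) = (fun s => f (s + h)) - (fun s => f (s - h)) from rfl,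
          iteratedDeriv_sub c1.contDiffAt c2.contDiffAt, iteratedDeriv_comp_add_const,
          iteratedDeriv_comp_sub_const]
      rw [this, abs_mul, abs_of_pos (by positivity)]
      calc _ ≤ 1 / (2 * h) * ((1 / h) ^ k + (1 / h) ^ k) := by
            gcongr
            exact (abs_sub _ _).trans (add_le_add (hb k hk' _) (hb k hk' _))
        _ = _ := by rw [pow_succ]; field_simp; ring

theorem exists_bump (p : ℕ) (hp : 1 ≤ p) : ∃ f : ℝ → ℝ, ContDiff ℝ (⊤ : ℕ∞) f ∧
    (∀ s, |s| ≤ 1 → f s = 1) ∧ (∀ s, 4 ≤ |s| → f s = 0) ∧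
    ∀ k ≤ p, ∀ s, |iteratedDeriv k f s| ≤ (p : ℝ) ^ k := by
  have hp' : (0:ℝ) < p := by exact_mod_cast hp
  set h : ℝ := 1 / p with hh
  have key : ∀ j : ℕ, ∃ f : ℝ → ℝ, ContDiff ℝ (⊤ : ℕ∞) f ∧
    (∀ s, |s| ≤ 2 - j * h → f s = 1) ∧ (∀ s, 3 + j * h ≤ |s| → f s = 0) ∧
    ∀ k ≤ j, ∀ s, |iteratedDeriv k f s| ≤ (1 / h) ^ k := by
    intro j
    induction j with
    | zero =>
      let φ : ContDiffBump (0:ℝ) := ⟨2, 3, by norm_num, by norm_num⟩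
      refine ⟨φ, φ.contDiff, ?_, ?_, ?_⟩
      · intro s hs
        apply φ.one_of_mem_closedBall
        simpa using hs
      · intro s hs
        apply φ.zero_of_le_dist
        simpa using hs
      · intro k hk s
        obtain rfl : k = 0 := by omega
        simp only [iteratedDeriv_zero, pow_zero]
        rw [abs_of_nonneg φ.nonneg]
        exact φ.le_one
    | succ j ih =>
      obtain ⟨f, c, h1, h0, hb⟩ := ih
      obtain ⟨g, c', h1', h0', hb'⟩ := steklov_step (h := h) (by positivity) c h1 h0 hb
      refine ⟨g, c', fun s hs => h1' s ?_, fun s hs => h0' s ?_, hb'⟩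
      · push_cast at hs; linarith
      · push_cast at hs; linarith
  obtain ⟨f, c, h1, h0, hb⟩ := key p
  have e : (p:ℝ) * h = 1 := by rw [hh]; field_simp
  have e2 : 1 / h = p := by rw [hh]; simp
  rw [e] at h1 h0
  rw [e2] at hb
  exact ⟨f, c, fun s hs => h1 s (by linarith), fun s hs => h0 s (by linarith), hb⟩

theorem radial_bound {E : Type*} [NormedAddCommGroup E] [InnerProductSpace ℝ E] {R : ℝ} 
    (x : E) (hx : ‖x‖ ≤ 2) (k : ℕ) : ∀ (η : ℝ → ℝ) (K : ℝ), (k : ℝ) ≤ R → ContDiff ℝ (⊤ : ℕ∞) η →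
    (∀ j ≤ k, ∀ s, |iteratedDeriv j η s| ≤ K * R ^ j) →
    ‖iteratedFDeriv ℝ k (fun y : E => η (‖y‖ ^ 2)) x‖ ≤ K * (5 * R) ^ k := by
  induction k using Nat.strong_induction_on with
  | _ k ih =>
  intro η K hR hη hb
  have hK : 0 ≤ K := by simpa using (abs_nonneg _).trans (hb 0 (Nat.zero_le _) 0)
  cases k with
  | zero => simpa using hb 0 le_rfl _
  | succ k =>
    have hR0 : 0 ≤ R := le_trans (by positivity) hR
    obtain ⟨S, hSa, hS⟩ : ∃ S : E →L[ℝ] E →L[ℝ] ℝ, (∀ y v, S y v = 2 * ⟪y, v⟫) ∧ ‖S‖ ≤ 2 := by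
      let T : E →L[ℝ] E →L[ℝ] ℝ := innerSL ℝ
      have hT : ∀ y v, T y v = ⟪y, v⟫ := fun _ _ => rfl
      refine ⟨(2:ℝ) • T, fun y v => by simp [hT], ?_⟩
      apply ContinuousLinearMap.opNorm_le_bound₂ _ (by norm_num)
      intro y v
      have := norm_inner_le_norm (𝕜 := ℝ) y v
      simp only [smul_apply, hT, norm_smul, Real.norm_ofNat]
      linarith
    have hd : fderiv ℝ (fun y : E => η (‖y‖ ^ 2)) = fun y => (deriv η (‖y‖ ^ 2)) • S y := by
      funext y
      have h1 : HasFDerivAt (fun y : E => ‖y‖ ^ 2) (2 • innerSL ℝ y) y := by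
        exact (hasStrictFDerivAt_norm_sq y).hasFDerivAt
      have h2 : HasDerivAt η (deriv η (‖y‖ ^ 2)) (‖y‖ ^ 2) :=
        (hη.differentiable (by simp) _).hasDerivAt
      have h3 : HasFDerivAt (fun y : E => η (‖y‖ ^ 2)) _ y := h2.comp_hasFDerivAt y h1
      rw [h3.fderiv]
      ext v
      simp [hSa]
    have hη' : ContDiff ℝ (⊤ : ℕ∞) (deriv η) := ((contDiff_infty_iff_deriv).1 hη).2
    have hb' : ∀ j ≤ k, ∀ s, |iteratedDeriv j (deriv η) s| ≤ (K * R) * R ^ j := by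
      intro j hj s
      rw [← iteratedDeriv_succ']
      refine (hb (j+1) (by omega) s).trans (le_of_eq (by ring))
    rw [← norm_iteratedFDeriv_fderiv, hd]
    have hc1 : ContDiff ℝ (⊤ : ℕ∞) (fun y : E => deriv η (‖y‖ ^ 2)) := hη'.comp (contDiff_norm_sq ℝ)
    have hc2 : ContDiff ℝ (⊤ : ℕ∞) (fun y : E => S y) :=
      S.contDiff
    have hl0 : ‖iteratedFDeriv ℝ 0 (fun y : E => S y) x‖ ≤ 4 := by
      rw [norm_iteratedFDeriv_zero]
      refine (ContinuousLinearMap.le_opNorm _ _).trans ?_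
      nlinarith [norm_nonneg x]
    have hfd : fderiv ℝ (fun y : E => S y) = fun _ => S := by
      funext y; exact ContinuousLinearMap.fderiv _
    have hl1 : ‖iteratedFDeriv ℝ 1 (fun y : E => S y) x‖ ≤ 2 := by
      have := norm_iteratedFDeriv_fderiv (𝕜 := ℝ) (f := fun y : E => S y) (x := x) (n := 0)
      rw [zero_add] at this
      rw [← this, hfd]
      simpa using hS
    have hl2 : ∀ n, ‖iteratedFDeriv ℝ (n+2) (fun y : E => S y) x‖ = 0 := by
      intro n
      rw [← norm_iteratedFDeriv_fderiv, hfd, iteratedFDeriv_const_of_ne (by simp)]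
      simp
    refine (norm_iteratedFDeriv_smul_le (N := (⊤ : ℕ∞)) hc1 hc2 x (n := k) (by exact_mod_cast le_top)).trans ?_
    have ih1 := ih k (by omega) (deriv η) (K * R) (by push_cast at hR; linarith) hη' hb'
    rw [Finset.sum_range_succ]
    have t1 : ((k.choose k : ℕ) : ℝ) * ‖iteratedFDeriv ℝ k (fun y : E => deriv η (‖y‖ ^ 2)) x‖ *
      ‖iteratedFDeriv ℝ (k - k) (fun y : E => S y) x‖ ≤ (K * R) * (5 * R) ^ k * 4 := by
      rw [Nat.sub_self, Nat.choose_self, Nat.cast_one, one_mul]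
      gcongr
    cases k with
    | zero =>
      simp only [Finset.range_zero, Finset.sum_empty, zero_add]
      refine t1.trans ?_
      simp; nlinarith [mul_nonneg hK hR0]
    | succ k =>
      have ih2 := ih k (by omega) (deriv η) (K * R) (by push_cast at hR; linarith) hη'
        (fun j hj => hb' j (by omega))
      have t2 : ∑ i ∈ Finset.range (k+1), (((k+1).choose i : ℕ) : ℝ) * ‖iteratedFDeriv ℝ i (fun y : E => deriv η (‖y‖ ^ 2)) x‖ *
        ‖iteratedFDeriv ℝ (k + 1 - i) (fun y : E => S y) x‖ ≤ R * ((K * R) * (5 * R) ^ k) * 2 := by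
        rw [Finset.sum_range_succ, Finset.sum_eq_zero, zero_add]
        · rw [Nat.add_sub_cancel_left]
          have : (((k+1).choose k : ℕ) : ℝ) ≤ R := by
            simp; push_cast at hR; linarith
          gcongr
        · intro i hi
          have : i < k := Finset.mem_range.1 hi
          obtain ⟨m, rfl⟩ : ∃ m, k = i + m + 1 := ⟨k - i - 1, by omega⟩
          rw [show i + m + 1 + 1 - i = m + 2 by omega, hl2, mul_zero]
      refine (add_le_add t2 t1).trans ?_
      have : 0 ≤ K * R * R * (5 * R) ^ k := by positivity
      rw [pow_succ, pow_succ (5 * R) (k+1), pow_succ]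
      nlinarith


theorem exists_cutoff {E : Type*} [NormedAddCommGroup E] [InnerProductSpace ℝ E] {u : E → ℝ}
    (hu : ContDiff ℝ (⊤ : ℕ∞) u) (p : ℕ) (hp : 1 ≤ p) (K : ℝ)
    (hK : ∀ x, ‖iteratedFDeriv ℝ p u x‖ ≤ K) :
    ∃ w : E → ℝ, ContDiff ℝ (⊤ : ℕ∞) w ∧ (∀ x, ‖x‖ ≤ 1 → w x = u x - tpol u p x) ∧
      (∀ x, 2 ≤ ‖x‖ → w x = 0) ∧ ∀ x, ‖iteratedFDeriv ℝ p w x‖ ≤ K * 33 ^ p := by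
  obtain ⟨η, hη, h1, h0, hb⟩ := exists_bump p hp
  have hK0 : 0 ≤ K := (norm_nonneg _).trans (hK 0)
  have hrc : ContDiff ℝ (⊤ : ℕ∞) (fun y => u y - tpol u p y) := hu.sub (tpol_contDiff u p)
  have hχ : ContDiff ℝ (⊤ : ℕ∞) (fun y : E => η (‖y‖ ^ 2)) := hη.comp (contDiff_norm_sq ℝ)
  have hz : ∀ x : E, 2 ≤ ‖x‖ → η (‖x‖ ^ 2) * (u x - tpol u p x) = 0 := by
    intro x hx
    rw [h0, zero_mul]
    rw [abs_of_nonneg (by positivity)]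
    nlinarith
  refine ⟨fun y => η (‖y‖ ^ 2) * (u y - tpol u p y), hχ.mul hrc, ?_, hz, ?_⟩
  · intro x hx
    simp only
    rw [h1, one_mul]
    rw [abs_of_nonneg (by positivity)]
    nlinarith [norm_nonneg x]
  · intro x
    rcases le_or_gt ‖x‖ 2 with hx | hx
    · refine (norm_iteratedFDeriv_mul_le (N := (⊤ : ℕ∞)) hχ hrc x (n := p) (by exact_mod_cast le_top)).trans ?_
      have hterm : ∀ i ∈ Finset.range (p + 1), (p.choose i : ℝ) *
          ‖iteratedFDeriv ℝ i (fun y : E => η (‖y‖ ^ 2)) x‖ *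
          ‖iteratedFDeriv ℝ (p - i) (fun y => u y - tpol u p y) x‖ ≤
          (K * 3 ^ p) * (10 ^ i * 1 ^ (p - i) * (p.choose i : ℝ)) := by
        intro i hi
        have hip : i ≤ p := by have := Finset.mem_range.1 hi; omega
        have b1 := radial_bound (R := p) x hx i η 1 (by exact_mod_cast hip) hη
          (fun j hj s => by rw [one_mul]; exact hb j (hj.trans hip) s)
        have b2 := taylor_bound hu p K hK i hip x
        have b3 : K * ‖x‖ ^ i / i.factorial ≤ K * 2 ^ i / i.factorial := by gcongr
        have b4 : (p:ℝ) ^ i / i.factorial ≤ 3 ^ p := by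
          refine (Real.pow_div_factorial_le_exp (p:ℝ) (by positivity) i).trans ?_
          rw [← Real.exp_one_pow]
          gcongr
          linarith [Real.exp_one_lt_d9]
        calc _ ≤ (p.choose i : ℝ) * (1 * (5 * p) ^ i) * (K * 2 ^ i / i.factorial) := by
              gcongr
              exact b2.trans b3
          _ = K * ((p:ℝ) ^ i / i.factorial) * (10 ^ i * 1 ^ (p - i) * (p.choose i : ℝ)) := by
              rw [mul_pow, show (10:ℝ) = 5 * 2 by norm_num, mul_pow]; simp; ring
          _ ≤ _ := by gcongr
      refine (Finset.sum_le_sum hterm).trans (le_of_eq ?_)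
      rw [← Finset.mul_sum, ← add_pow, mul_assoc, ← mul_pow]
      norm_num
    · have : (fun y => η (‖y‖ ^ 2) * (u y - tpol u p y)) =ᶠ[nhds x] fun _ => 0 := by
        filter_upwards [continuous_norm.continuousAt.eventually (lt_mem_nhds hx)] with y hy
        exact hz y hy.le
      rw [(this.iteratedFDeriv ℝ p).eq_of_nhds]
      simp only [iteratedFDeriv_zero_fun, Pi.zero_apply, norm_zero]
      simp
      positivity


theorem mid_perm {d n : ℕ} (I : Fin n → Fin d) :
    (multiIndexDirs fun i => (List.ofFn I).count i).Perm (List.ofFn I) := by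
  rw [List.perm_iff_count]
  intro a
  unfold multiIndexDirs
  rw [List.count_flatMap]
  rw [show ((List.finRange d).map (List.count a ∘ fun i => List.replicate (List.count i (List.ofFn I)) i)).sum
    = ∑ i : Fin d, (List.count a (List.replicate (List.count i (List.ofFn I)) i)) from by
      rw [Fin.sum_univ_def]; rfl]
  simp only [List.count_replicate]
  rw [Finset.sum_eq_single a]
  · simp
  · intro b _ hb
    simp [hb]
  · simp

theorem count_sum {d n : ℕ} (I : Fin n → Fin d) : (∑ i, (List.ofFn I).count i) = n := by
  have h := Multiset.sum_count_eq_card (s := Finset.univ) (m := (List.ofFn I : Multiset (Fin d)))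
    (by simp)
  simpa using h

theorem mderiv_eq {d n : ℕ} {u : EuclideanSpace ℝ (Fin d) → ℝ} (hu : ContDiff ℝ (⊤ : ℕ∞) u)
    (I : Fin n → Fin d) (x : EuclideanSpace ℝ (Fin d)) :
    iteratedFDeriv ℝ n u x (fun j => EuclideanSpace.single (I j) 1) =
      mderiv (fun i => (List.ofFn I).count i) u x := by
  unfold mderiv
  rw [iteratedFDeriv_eq_lder, iteratedFDeriv_eq_lder]
  refine congrFun (lder_perm hu ?_) x
  have h := (mid_perm I).symm.map (fun i => (EuclideanSpace.single i (1 : ℝ)))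
  rw [List.map_ofFn] at h
  have h2 : ∀ l : List (Fin d), (List.ofFn fun k => (EuclideanSpace.single (l.get k) (1 : ℝ))) =
      l.map (fun i => EuclideanSpace.single i (1 : ℝ)) := by
    intro l
    conv_rhs => rw [← List.ofFn_get l, List.map_ofFn]
    rfl
  rw [h2]
  exact h

theorem expand_multi {d n : ℕ} (L : ContinuousMultilinearMap ℝ (fun _ : Fin n => EuclideanSpace ℝ (Fin d)) ℝ)
    (v : Fin n → EuclideanSpace ℝ (Fin d)) :
    L v = ∑ I : Fin n → Fin d, (∏ j, v j (I j)) * L (fun j => EuclideanSpace.single (I j) 1) := by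
  have h : v = fun j => ∑ i, (v j i) • (EuclideanSpace.single i (1 : ℝ)) := by
    funext j
    have := (EuclideanSpace.basisFun (Fin d) ℝ).sum_repr (v j)
    simpa using this.symm
  conv_lhs => rw [h]
  rw [L.map_sum]
  refine Finset.sum_congr rfl fun I _ => ?_
  rw [L.map_smul_univ (fun j => v j (I j)) (fun j => EuclideanSpace.single (I j) 1), smul_eq_mul]

theorem l1_le {d : ℕ} (v : EuclideanSpace ℝ (Fin d)) : ∑ i, |v i| ≤ √d * ‖v‖ := by
  rw [EuclideanSpace.norm_eq, ← Real.sqrt_mul (by positivity)]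
  apply Real.le_sqrt_of_sq_le
  have := sq_sum_le_card_mul_sum_sq (s := Finset.univ) (f := fun i => |v i|)
  simpa using this

theorem opnorm_of_mderiv {d p : ℕ} {u : EuclideanSpace ℝ (Fin d) → ℝ} (hu : ContDiff ℝ (⊤ : ℕ∞) u)
    (h : ∀ α : Fin d → ℕ, (∑ i, α i) = p → ∀ x, |mderiv α u x| ≤ 1) (x : EuclideanSpace ℝ (Fin d)) :
    ‖iteratedFDeriv ℝ p u x‖ ≤ (√d) ^ p := by
  refine ContinuousMultilinearMap.opNorm_le_bound (by positivity) fun v => ?_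
  rw [expand_multi, Real.norm_eq_abs]
  calc _ ≤ ∑ I : Fin p → Fin d, |(∏ j, v j (I j)) * iteratedFDeriv ℝ p u x (fun j => EuclideanSpace.single (I j) 1)| :=
        Finset.abs_sum_le_sum_abs _ _
    _ ≤ ∑ I : Fin p → Fin d, ∏ j, |v j (I j)| := by
        refine Finset.sum_le_sum fun I _ => ?_
        rw [abs_mul, Finset.abs_prod, mderiv_eq hu]
        exact mul_le_of_le_one_right (by positivity) (h _ (count_sum I) x)
    _ = ∏ j, ∑ i, |v j i| := by
        rw [Finset.prod_univ_sum, Fintype.piFinset_univ]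
    _ ≤ ∏ j, (√d * ‖v j‖) := by
        refine Finset.prod_le_prod (fun _ _ => by positivity) fun j _ => l1_le _
    _ = _ := by simp [Finset.prod_mul_distrib]

/-- equality of integrals of monomials given as products over words -/
theorem word_moment {d p n : ℕ} {μ ν : Measure (EuclideanSpace ℝ (Fin d))}
    (hm : ∀ α : Fin d → ℕ, (∑ i, α i) ≤ p - 1 →
        (∫ x, ∏ i, x i ^ α i ∂μ) = ∫ x, ∏ i, x i ^ α i ∂ν) (hn : n < p) (I : Fin n → Fin d) :
    (∫ x, ∏ j, x (I j) ∂μ) = ∫ x, ∏ j, x (I j) ∂ν := by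
  have h : ∀ x : EuclideanSpace ℝ (Fin d), ∏ j, x (I j) = ∏ i, x i ^ ((List.ofFn I).count i) := by
    intro x
    have h1 := Finset.prod_multiset_map_count (List.ofFn I : Multiset (Fin d)) (fun i => x i)
    simp only [Multiset.map_coe, Multiset.prod_coe, Multiset.coe_count, List.map_ofFn, List.prod_ofFn] at h1
    rw [show (∏ j, x (I j)) = ∏ i, ((fun i => x i) ∘ I) i from rfl, h1]
    refine Finset.prod_subset (Finset.subset_univ _) fun a _ ha => ?_
    have : a ∉ List.ofFn I := by simpa using ha
    rw [List.count_eq_zero_of_not_mem this, pow_zero]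
  simp only [h]
  exact hm _ (by rw [count_sum]; omega)

theorem ball_integrable {d : ℕ} {F : Type*} [NormedAddCommGroup F] {μ : Measure (EuclideanSpace ℝ (Fin d))}
    [IsProbabilityMeasure μ]
    (hμ : ∀ᵐ x ∂μ, ‖x‖ ≤ 1) {f : EuclideanSpace ℝ (Fin d) → F} (hf : Continuous f) : Integrable f μ := by
  obtain ⟨C, hC⟩ := (isCompact_closedBall (0 : EuclideanSpace ℝ (Fin d)) 1).exists_bound_of_continuousOn hf.continuousOn
  refine Integrable.of_bound hf.aestronglyMeasurable C ?_
  filter_upwards [hμ] with x hx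
  exact hC x (by simpa using hx)

theorem multi_moment {d p n : ℕ} {μ ν : Measure (EuclideanSpace ℝ (Fin d))}
    [IsProbabilityMeasure μ] [IsProbabilityMeasure ν]
    (hμ : ∀ᵐ x ∂μ, ‖x‖ ≤ 1) (hν : ∀ᵐ x ∂ν, ‖x‖ ≤ 1)
    (hm : ∀ α : Fin d → ℕ, (∑ i, α i) ≤ p - 1 →
        (∫ x, ∏ i, x i ^ α i ∂μ) = ∫ x, ∏ i, x i ^ α i ∂ν) (hn : n < p) 
    (L : ContinuousMultilinearMap ℝ (fun _ : Fin n => EuclideanSpace ℝ (Fin d)) ℝ) :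
    (∫ x, L (fun _ => x) ∂μ) = ∫ x, L (fun _ => x) ∂ν := by
  simp_rw [fun x : EuclideanSpace ℝ (Fin d) => expand_multi L (fun _ => x)]
  rw [integral_finsetSum, integral_finsetSum]
  · refine Finset.sum_congr rfl fun I _ => ?_
    rw [integral_mul_const, integral_mul_const, word_moment hm hn]
  · intro I _
    exact ball_integrable hν (by fun_prop)
  · intro I _
    exact ball_integrable hμ (by fun_prop)

theorem tpol_moment {d p : ℕ} {μ ν : Measure (EuclideanSpace ℝ (Fin d))}
    [IsProbabilityMeasure μ] [IsProbabilityMeasure ν]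
    (hμ : ∀ᵐ x ∂μ, ‖x‖ ≤ 1) (hν : ∀ᵐ x ∂ν, ‖x‖ ≤ 1)
    (hm : ∀ α : Fin d → ℕ, (∑ i, α i) ≤ p - 1 →
        (∫ x, ∏ i, x i ^ α i ∂μ) = ∫ x, ∏ i, x i ^ α i ∂ν) (u : EuclideanSpace ℝ (Fin d) → ℝ) :
    (∫ x, tpol u p x ∂μ) = ∫ x, tpol u p x ∂ν := by
  unfold tpol
  have hc : ∀ k, Continuous fun x : EuclideanSpace ℝ (Fin d) =>
      ((k.factorial : ℝ)⁻¹) * iteratedFDeriv ℝ k u 0 (fun _ => x) := by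
    intro k
    exact continuous_const.mul ((iteratedFDeriv ℝ k u 0).cont.comp (continuous_pi fun _ => continuous_id))
  rw [integral_finsetSum, integral_finsetSum]
  · refine Finset.sum_congr rfl fun k hk => ?_
    rw [integral_const_mul, integral_const_mul, multi_moment hμ hν hm (Finset.mem_range.1 hk)]
  · intro k _
    exact ball_integrable hν (hc k)
  · intro k _
    exact ball_integrable hμ (hc k)


section FT6
open scoped FourierTransform SchwartzMap LineDeriv

theorem schwartz_int {d : ℕ} (f : 𝓢(EuclideanSpace ℝ (Fin d), ℂ)) (k : ℕ) :
    Integrable (fun t => ‖t‖ ^ k * ‖f t‖ ^ 2) := by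
  obtain ⟨C, hC⟩ : ∃ C, ∀ x, ‖f x‖ ≤ C := by
    obtain ⟨C, -, hC⟩ := f.decay 0 0
    exact ⟨C, fun x => by simpa using hC x⟩
  refine ((f.integrable_pow_mul volume k).mul_const C).mono' ?_ (Filter.Eventually.of_forall fun t => ?_)
  · exact (by fun_prop : Continuous fun t => ‖t‖ ^ k * ‖f t‖ ^ 2).aestronglyMeasurable
  · rw [Real.norm_of_nonneg (by positivity), sq, ← mul_assoc]
    gcongr
    exact hC t

theorem plancherel_bound {d : ℕ} (n : ℕ) : ∀ (f : 𝓢(EuclideanSpace ℝ (Fin d), ℂ)) (K : ℝ),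
    (∀ x, ‖iteratedFDeriv ℝ n f x‖ ≤ K) → tsupport f ⊆ Metric.closedBall 0 2 →
    ∫ t, (2 * Real.pi * ‖t‖) ^ (2 * n) * ‖𝓕 f t‖ ^ 2 ≤
      (d : ℝ) ^ n * (K ^ 2 * volume.real (Metric.closedBall (0 : EuclideanSpace ℝ (Fin d)) 2)) := by
  induction n with
  | zero =>
    intro f K hK hf
    simp only [mul_zero, pow_zero, one_mul]
    rw [SchwartzMap.integral_norm_sq_fourier]
    have h0 : ∀ x, x ∉ Metric.closedBall (0 : EuclideanSpace ℝ (Fin d)) 2 → ‖f x‖ ^ 2 = 0 := by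
      intro x hx
      rw [image_eq_zero_of_notMem_tsupport fun h => hx (hf h)]
      simp
    rw [← setIntegral_eq_integral_of_forall_compl_eq_zero h0]
    have h1 := norm_setIntegral_le_of_norm_le_const (μ := volume)
      (s := Metric.closedBall (0 : EuclideanSpace ℝ (Fin d)) 2) (f := fun x => ‖f x‖ ^ 2) (C := K ^ 2)
      (measure_closedBall_lt_top) (fun x _ => by
        have := hK x
        rw [norm_iteratedFDeriv_zero] at this
        rw [norm_pow, norm_norm]
        gcongr)
    exact (le_abs_self _).trans h1
  | succ n ih =>
    intro f K hK hf
    have hstep : ∀ i : Fin d, ∫ t, (2 * Real.pi * ‖t‖) ^ (2 * n) *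
        ‖𝓕 (∂_{(EuclideanSpace.single i (1 : ℝ) : EuclideanSpace ℝ (Fin d))} f) t‖ ^ 2 ≤
        (d : ℝ) ^ n * (K ^ 2 * volume.real (Metric.closedBall (0 : EuclideanSpace ℝ (Fin d)) 2)) := by
      intro i
      refine ih _ K (fun x => ?_) ((SchwartzMap.tsupport_lineDerivOp_subset _ f).trans hf)
      have h1 := norm_iteratedFDeriv_clm_apply_const (𝕜 := ℝ) (n := n) (N := n) (f := fderiv ℝ f)
        (c := (EuclideanSpace.single i (1 : ℝ) : EuclideanSpace ℝ (Fin d))) (x := x)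
        ((f.smooth (n + 1)).fderiv_right le_rfl).contDiffAt le_rfl
      rw [norm_iteratedFDeriv_fderiv] at h1
      simp only [EuclideanSpace.norm_single, norm_one, one_mul] at h1
      exact h1.trans (hK x)
    have hpt : ∀ t : EuclideanSpace ℝ (Fin d), (2 * Real.pi * ‖t‖) ^ (2 * (n + 1)) * ‖𝓕 f t‖ ^ 2 =
        ∑ i, (2 * Real.pi * ‖t‖) ^ (2 * n) *
        ‖𝓕 (∂_{(EuclideanSpace.single i (1 : ℝ) : EuclideanSpace ℝ (Fin d))} f) t‖ ^ 2 := by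
      intro t
      have h2 : ∀ i : Fin d, ‖𝓕 (∂_{(EuclideanSpace.single i (1 : ℝ) : EuclideanSpace ℝ (Fin d))} f) t‖ ^ 2 =
          (2 * Real.pi) ^ 2 * ‖t i‖ ^ 2 * ‖𝓕 f t‖ ^ 2 := by
        intro i
        rw [SchwartzMap.fourier_lineDerivOp_eq]
        have h3 : (fun t : EuclideanSpace ℝ (Fin d) => inner ℝ t
          (EuclideanSpace.single i (1 : ℝ) : EuclideanSpace ℝ (Fin d))).HasTemperateGrowth := by fun_prop
        rw [smul_apply, SchwartzMap.smulLeftCLM_apply_apply h3]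
        simp [norm_smul, mul_pow, abs_of_pos Real.pi_pos, EuclideanSpace.inner_single_right]
        ring
      simp_rw [h2]
      rw [← Finset.mul_sum, ← Finset.sum_mul, ← Finset.mul_sum, ← EuclideanSpace.norm_sq_eq]
      ring
    simp_rw [hpt]
    rw [integral_finsetSum]
    · calc _ ≤ ∑ i : Fin d, (d : ℝ) ^ n * (K ^ 2 * volume.real (Metric.closedBall (0 : EuclideanSpace ℝ (Fin d)) 2)) :=
            Finset.sum_le_sum fun i _ => hstep i
        _ = _ := by
          simp
          ring
    · intro i _
      have := (schwartz_int (𝓕 (∂_{(EuclideanSpace.single i (1 : ℝ) : EuclideanSpace ℝ (Fin d))} f)) (2 * n)).const_mul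
        ((2 * Real.pi) ^ (2 * n))
      refine this.congr (Filter.Eventually.of_forall fun t => ?_)
      simp only [mul_pow]
      ring

theorem vol_bound (d : ℕ) : volume.real (Metric.closedBall (0 : EuclideanSpace ℝ (Fin d)) 2) ≤ 4 ^ d := by
  have h := PiLp.volume_preserving_ofLp (Fin d)
  have hs : Metric.closedBall (0 : EuclideanSpace ℝ (Fin d)) 2 ⊆
      (@WithLp.ofLp 2 (Fin d → ℝ)) ⁻¹' (Set.Icc (fun _ => -2) (fun _ => 2)) := by
    intro x hx
    have hx' : ‖x‖ ≤ 2 := by simpa using hx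
    have h1 : ∀ i, |x i| ≤ 2 := fun i => (PiLp.norm_apply_le x i).trans hx'
    simp only [Set.mem_preimage, Set.mem_Icc, Pi.le_def]
    exact ⟨fun i => (abs_le.1 (h1 i)).1, fun i => (abs_le.1 (h1 i)).2⟩
  have hm : volume ((@WithLp.ofLp 2 (Fin d → ℝ)) ⁻¹' (Set.Icc (fun _ => (-2 : ℝ)) (fun _ => 2))) =
      4 ^ d := by
    rw [h.measure_preimage measurableSet_Icc.nullMeasurableSet, Real.volume_Icc_pi]
    norm_num
  have h2 := measure_mono (μ := volume) hs
  rw [hm] at h2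
  unfold Measure.real
  have := ENNReal.toReal_mono (by finiteness) h2
  simpa using this

end FT6


section FT7
open scoped FourierTransform

def ee (s : ℝ) : ℂ := Complex.exp (((2 * Real.pi * s : ℝ) : ℂ) * Complex.I)

theorem ee_add (s t : ℝ) : ee (s + t) = ee s * ee t := by
  unfold ee
  rw [← Complex.exp_add]
  congr 1
  push_cast
  ring

theorem norm_ee (s : ℝ) : ‖ee s‖ = 1 := by
  exact Complex.norm_exp_ofReal_mul_I _

theorem continuous_ee : Continuous ee := by
  unfold ee
  fun_prop

theorem fourierInv_int {d : ℕ} {a : EuclideanSpace ℝ (Fin d) → ℂ} (ha : Integrable a)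
    {b : EuclideanSpace ℝ (Fin d) → ℂ} (hb : Continuous b) (C : ℝ) (hC : ∀ t, ‖b t‖ ≤ C) :
    Integrable (fun t => a t * b t) := by
  exact ha.mul_bdd hb.aestronglyMeasurable (Filter.Eventually.of_forall hC)

theorem char_cont {d : ℕ} (y : EuclideanSpace ℝ (Fin d)) :
    Continuous fun t : EuclideanSpace ℝ (Fin d) => ee ⟪t, y⟫ := by
  exact continuous_ee.comp (by fun_prop)

theorem fourierInv_eq' {d : ℕ} (a : EuclideanSpace ℝ (Fin d) → ℂ) (x : EuclideanSpace ℝ (Fin d)) :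
    𝓕⁻ a x = ∫ t, a t * ee ⟪t, x⟫ := by
  rw [Real.fourierInv_eq]
  congr 1; funext t
  rw [Circle.smul_def, smul_eq_mul, mul_comm, Real.fourierChar_apply]
  rfl

theorem fourierInv_shift {d : ℕ} {a : EuclideanSpace ℝ (Fin d) → ℂ} (ha : Integrable a)
    (x y : EuclideanSpace ℝ (Fin d)) :
    𝓕⁻ (fun t => a t * (ee ⟪t, y⟫ - 1)) x = 𝓕⁻ a (x + y) - 𝓕⁻ a x := by
  rw [fourierInv_eq', fourierInv_eq', fourierInv_eq', ← integral_sub]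
  · congr 1; funext t
    rw [inner_add_right, ee_add]
    ring
  · exact fourierInv_int ha (char_cont _) 1 (fun _ => (norm_ee _).le)
  · exact fourierInv_int ha (char_cont _) 1 (fun _ => (norm_ee _).le)

theorem smoothing_bound {d : ℕ} (γ : Measure (EuclideanSpace ℝ (Fin d))) [IsProbabilityMeasure γ]
    (g : EuclideanSpace ℝ (Fin d) → ℂ) (hg : Continuous g) (hg1 : ∀ t, ‖1 - g t‖ ≤ 1)
    (hγ : ∀ t, ∫ y, ee ⟪t, y⟫ ∂γ = g t) (hi : Integrable (fun y => ‖y‖) γ)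
    (c : ℝ) (hc : ∫ y, ‖y‖ ∂γ ≤ c) (p : ℕ) :
    ∀ (a : EuclideanSpace ℝ (Fin d) → ℂ) (K : ℝ), 0 ≤ K → Integrable a → ContDiff ℝ (⊤ : ℕ∞) (𝓕⁻ a) →
      (∀ x, ‖iteratedFDeriv ℝ p (𝓕⁻ a) x‖ ≤ K) → ∀ x,
      ‖𝓕⁻ (fun t => a t * (1 - g t) ^ p) x‖ ≤ c ^ p * K := by
  have hc0 : 0 ≤ c := le_trans (by positivity) hc
  have hgb : ∀ n t, ‖(1 - g t) ^ n‖ ≤ 1 := fun n t => by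
    rw [norm_pow]; exact pow_le_one₀ (norm_nonneg _) (hg1 t)
  induction p with
  | zero =>
    intro a K hK0 ha hs hK x
    have := hK x
    rw [norm_iteratedFDeriv_zero] at this
    simpa using this
  | succ p ih =>
    intro a K hK0 ha hs hK x
    have ha' : Integrable fun t => a t * (1 - g t) ^ p := fourierInv_int ha (by fun_prop) 1 (hgb p)
    have hlip : ∀ x y, ‖𝓕⁻ (fun t => a t * (1 - g t) ^ p) (x + y) -
        𝓕⁻ (fun t => a t * (1 - g t) ^ p) x‖ ≤ c ^ p * (K * ‖y‖) := by
      intro x y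
      have h1 := ih (fun t => a t * (ee ⟪t, y⟫ - 1)) (K * ‖y‖) (by positivity)
        (fourierInv_int ha ((char_cont y).sub continuous_const) 2 (fun t => by
          refine (norm_sub_le _ _).trans ?_
          simp [norm_ee]; norm_num))
        (by
          rw [show 𝓕⁻ (fun t => a t * (ee ⟪t, y⟫ - 1)) = fun x => 𝓕⁻ a (x + y) - 𝓕⁻ a x from
            funext fun x => fourierInv_shift ha x y]
          exact (hs.comp (contDiff_id.add contDiff_const)).sub hs)
        (fun x => by
          rw [show 𝓕⁻ (fun t => a t * (ee ⟪t, y⟫ - 1)) = (fun x => 𝓕⁻ a (x + y)) - 𝓕⁻ a from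
            funext fun x => fourierInv_shift ha x y]
          have hsp : ContDiff ℝ (p : ℕ∞) (𝓕⁻ a) := hs.of_le (by exact_mod_cast le_top)
          have hsq : ContDiff ℝ (p : ℕ∞) fun x => 𝓕⁻ a (x + y) :=
            hsp.comp (contDiff_id.add contDiff_const)
          rw [iteratedFDeriv_sub_apply (i := p)
            hsq.contDiffAt hsp.contDiffAt,
            iteratedFDeriv_comp_add_right]
          have hd : Differentiable ℝ (iteratedFDeriv ℝ p (𝓕⁻ a)) :=
            hs.differentiable_iteratedFDeriv (by exact_mod_cast ENat.natCast_lt_top _)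
          have := Convex.norm_image_sub_le_of_norm_fderiv_le (𝕜 := ℝ) (s := Set.univ) (f := iteratedFDeriv ℝ p (𝓕⁻ a))
            (C := K) (x := x) (y := x + y) (fun z _ => hd z) (fun z _ => by
              rw [norm_fderiv_iteratedFDeriv]; exact hK z) convex_univ (Set.mem_univ _) (Set.mem_univ _)
          simpa using this) x
      rw [← fourierInv_shift ha']
      convert h1 using 4
      ring
    have hfub : 𝓕⁻ (fun t => a t * (1 - g t) ^ (p + 1)) x =
        ∫ y, (𝓕⁻ (fun t => a t * (1 - g t) ^ p) x - 𝓕⁻ (fun t => a t * (1 - g t) ^ p) (x + y)) ∂γ := by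
      have e1 : ∀ t, a t * (1 - g t) ^ (p + 1) * ee ⟪t, x⟫ =
          ∫ y, (a t * (1 - g t) ^ p) * (ee ⟪t, x⟫ - ee ⟪t, x + y⟫) ∂γ := by
        intro t
        have hi1 : Integrable (fun y => ee ⟪t, y⟫) γ := by
          refine Integrable.of_bound ?_ 1 (Filter.Eventually.of_forall fun y => (norm_ee _).le)
          exact (continuous_ee.comp (by fun_prop)).aestronglyMeasurable
        rw [integral_const_mul]
        simp_rw [inner_add_right, ee_add]
        rw [integral_sub (integrable_const _) (hi1.const_mul _), integral_const_mul, hγ]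
        simp
        ring
      rw [fourierInv_eq']
      simp_rw [e1]
      rw [integral_integral_swap]
      · congr 1; funext y
        rw [fourierInv_eq', fourierInv_eq', ← integral_sub]
        · congr 1; funext t; ring
        · exact fourierInv_int ha' (char_cont _) 1 (fun _ => (norm_ee _).le)
        · exact fourierInv_int ha' (char_cont _) 1 (fun _ => (norm_ee _).le)
      · have hp := ha'.comp_fst γ
        refine hp.mul_bdd (c := 2) ?_ ?_
        · have : Continuous fun z : EuclideanSpace ℝ (Fin d) × EuclideanSpace ℝ (Fin d) =>
              (ee ⟪z.1, x⟫ - ee ⟪z.1, x + z.2⟫) :=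
            (continuous_ee.comp (by fun_prop)).sub
            (continuous_ee.comp (by fun_prop))
          exact this.aestronglyMeasurable
        · refine Filter.Eventually.of_forall fun z => ?_
          refine (norm_sub_le _ _).trans ?_
          simp [norm_ee]; norm_num
    rw [hfub]
    calc _ ≤ ∫ y, c ^ p * (K * ‖y‖) ∂γ := by
          refine norm_integral_le_of_norm_le ((hi.const_mul _).const_mul _) (Filter.Eventually.of_forall fun y => ?_)
          rw [norm_sub_rev]
          exact hlip x y
      _ = c ^ p * (K * ∫ y, ‖y‖ ∂γ) := by rw [integral_const_mul, integral_const_mul]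
      _ ≤ c ^ p * (K * c) := by gcongr
      _ = _ := by ring

end FT7


theorem std_sq (d : ℕ) : ∫ z, ‖z‖ ^ 2 ∂(ProbabilityTheory.stdGaussian (EuclideanSpace ℝ (Fin d))) = d := by
  have hL : ∀ i : Fin d, MemLp (fun z : EuclideanSpace ℝ (Fin d) => z i) 2
      (ProbabilityTheory.stdGaussian (EuclideanSpace ℝ (Fin d))) := fun i =>
    (ProbabilityTheory.IsGaussian.memLp_two_id (μ := ProbabilityTheory.stdGaussian (EuclideanSpace ℝ (Fin d)))).continuousLinearMap_comp
      (EuclideanSpace.proj i : EuclideanSpace ℝ (Fin d) →L[ℝ] ℝ)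
  have h1 : ∀ i : Fin d, ∫ z : EuclideanSpace ℝ (Fin d), ‖z i‖ ^ 2 ∂(ProbabilityTheory.stdGaussian (EuclideanSpace ℝ (Fin d))) = 1 := by
    intro i
    have e : ∀ z : EuclideanSpace ℝ (Fin d), (innerSL ℝ (EuclideanSpace.single i (1 : ℝ))) z = z i := by
      intro z
      simp [EuclideanSpace.inner_single_left]
    have hv := ProbabilityTheory.variance_dual_stdGaussian (E := EuclideanSpace ℝ (Fin d)) (innerSL ℝ (EuclideanSpace.single i (1 : ℝ)))
    rw [ProbabilityTheory.variance_of_integral_eq_zero (by fun_prop) (ProbabilityTheory.integral_strongDual_stdGaussian _)] at hv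
    simp only [e] at hv
    simp only [Real.norm_eq_abs, sq_abs]
    rw [hv]
    simp
  simp_rw [EuclideanSpace.norm_sq_eq]
  rw [integral_finsetSum]
  · rw [Finset.sum_congr rfl fun i _ => h1 i]
    simp
  · intro i _
    simp only [Real.norm_eq_abs, sq_abs]
    exact (hL i).integrable_sq

theorem std_int (d : ℕ) : Integrable (fun z => ‖z‖) (ProbabilityTheory.stdGaussian (EuclideanSpace ℝ (Fin d))) := by
  exact (ProbabilityTheory.IsGaussian.integrable_id (μ := ProbabilityTheory.stdGaussian (EuclideanSpace ℝ (Fin d)))).norm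

theorem std_norm (d : ℕ) : ∫ z, ‖z‖ ∂(ProbabilityTheory.stdGaussian (EuclideanSpace ℝ (Fin d))) ≤ √d := by
  apply Real.le_sqrt_of_sq_le
  have hm : MemLp (fun z => ‖z‖) 2 (ProbabilityTheory.stdGaussian (EuclideanSpace ℝ (Fin d))) :=
    (ProbabilityTheory.IsGaussian.memLp_two_id (μ := ProbabilityTheory.stdGaussian (EuclideanSpace ℝ (Fin d)))).norm
  have h1 := ProbabilityTheory.variance_eq_sub hm
  have h2 := ProbabilityTheory.variance_nonneg (fun z => ‖z‖) (ProbabilityTheory.stdGaussian (EuclideanSpace ℝ (Fin d)))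
  rw [h1] at h2
  have h3 := std_sq d
  simp only [Pi.pow_apply] at h2
  linarith

theorem gauss_char {d : ℕ} (σ : ℝ) (t : EuclideanSpace ℝ (Fin d)) :
    ∫ y, ee ⟪t, y⟫ ∂((ProbabilityTheory.stdGaussian (EuclideanSpace ℝ (Fin d))).map (fun z => σ • z)) =
      (Real.exp (-(2 * Real.pi ^ 2 * σ ^ 2 * ‖t‖ ^ 2)) : ℂ) := by
  have hc : Continuous fun y : EuclideanSpace ℝ (Fin d) => ee ⟪t, y⟫ := continuous_ee.comp (by fun_prop)
  rw [integral_map (by fun_prop) hc.aestronglyMeasurable]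
  have h := ProbabilityTheory.charFun_stdGaussian ((2 * Real.pi * σ) • t)
  rw [charFun_apply] at h
  unfold ee
  convert h using 1
  · congr 1; funext z
    rw [real_inner_smul_right, real_inner_smul_right, real_inner_comm]
    congr 3
    ring
  · rw [Complex.ofReal_exp]
    congr 1
    have e : ‖(2 * Real.pi * σ) • t‖ ^ 2 = (2 * Real.pi * σ) ^ 2 * ‖t‖ ^ 2 := by
      rw [norm_smul, mul_pow, Real.norm_eq_abs, sq_abs]
    rw [← Complex.ofReal_pow, e]
    push_cast
    ring

theorem smoothing {d : ℕ} (σ : ℝ) (hσ : 0 < σ) (p : ℕ) (a : EuclideanSpace ℝ (Fin d) → ℂ) (K : ℝ) (hK : 0 ≤ K)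
    (ha : Integrable a) (hs : ContDiff ℝ (⊤ : ℕ∞) (FourierTransformInv.fourierInv a))
    (hD : ∀ x, ‖iteratedFDeriv ℝ p (FourierTransformInv.fourierInv a) x‖ ≤ K)
    (x : EuclideanSpace ℝ (Fin d)) :
    ‖FourierTransformInv.fourierInv (fun t => a t * (1 - (Real.exp (-(2 * Real.pi ^ 2 * σ ^ 2 * ‖t‖ ^ 2)) : ℂ)) ^ p) x‖
      ≤ (σ * √d) ^ p * K := by
  have : IsProbabilityMeasure ((ProbabilityTheory.stdGaussian (EuclideanSpace ℝ (Fin d))).map (fun z => σ • z)) :=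
    Measure.isProbabilityMeasure_map (by fun_prop)
  refine smoothing_bound ((ProbabilityTheory.stdGaussian (EuclideanSpace ℝ (Fin d))).map (fun z => σ • z))
    _ (by fun_prop) (fun t => ?_) (gauss_char σ) ?_ (σ * √d) ?_ p a K hK ha hs hD x
  · have h1 : Real.exp (-(2 * Real.pi ^ 2 * σ ^ 2 * ‖t‖ ^ 2)) ≤ 1 := by
      rw [Real.exp_le_one_iff]
      have : 0 ≤ 2 * Real.pi ^ 2 * σ ^ 2 * ‖t‖ ^ 2 := by positivity
      linarith
    have h2 := Real.exp_pos (-(2 * Real.pi ^ 2 * σ ^ 2 * ‖t‖ ^ 2))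
    rw [← Complex.ofReal_one, ← Complex.ofReal_sub, Complex.norm_real, Real.norm_eq_abs, abs_le]
    constructor <;> linarith
  · rw [integrable_map_measure (by fun_prop) (by fun_prop)]
    have := (std_int d).const_mul σ
    refine this.congr (Filter.Eventually.of_forall fun z => ?_)
    simp [norm_smul, abs_of_pos hσ]
  · rw [integral_map (by fun_prop) (by fun_prop)]
    simp only [norm_smul, Real.norm_eq_abs, abs_of_pos hσ]
    rw [integral_const_mul]
    exact mul_le_mul_of_nonneg_left (std_norm d) hσ.le


theorem inner_moment {d p : ℕ} {μ ν : Measure (EuclideanSpace ℝ (Fin d))}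
    [IsProbabilityMeasure μ] [IsProbabilityMeasure ν]
    (hμ : ∀ᵐ x ∂μ, ‖x‖ ≤ 1) (hν : ∀ᵐ x ∂ν, ‖x‖ ≤ 1)
    (hm : ∀ α : Fin d → ℕ, (∑ i, α i) ≤ p - 1 →
        (∫ x, ∏ i, x i ^ α i ∂μ) = ∫ x, ∏ i, x i ^ α i ∂ν) (θ : EuclideanSpace ℝ (Fin d)) (k : ℕ) (hk : k < p) :
    (∫ x, (⟪x, θ⟫ + 1) ^ k ∂μ) = ∫ x, (⟪x, θ⟫ + 1) ^ k ∂ν := by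
  simp_rw [add_pow]
  rw [integral_finsetSum, integral_finsetSum]
  · refine Finset.sum_congr rfl fun j hj => ?_
    rw [integral_mul_const, integral_mul_const, integral_mul_const, integral_mul_const]
    congr 2
    have h := multi_moment (n := j) hμ hν hm (by have := Finset.mem_range.1 hj; omega)
      ((ContinuousMultilinearMap.mkPiAlgebra ℝ (Fin j) ℝ).compContinuousLinearMap (fun _ => innerSL ℝ θ))
    simpa [real_inner_comm] using h
  · intro I _
    exact ball_integrable hν (by fun_prop)
  · intro I _
    exact ball_integrable hμ (by fun_prop)

theorem taylor1 {p : ℕ} (hp : 1 ≤ p) {v : ℝ → ℝ} (hv : ContDiff ℝ (p : ℕ∞) v)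
    (hb : ∀ t, |iteratedDeriv p v t| ≤ 1) : ∃ c : ℕ → ℝ, ∀ x ∈ Set.Icc (-1 : ℝ) 1,
      |v x - ∑ k ∈ Finset.range p, c k * (x + 1) ^ k| ≤ 2 ^ p := by
  obtain ⟨n, rfl⟩ : ∃ n, p = n + 1 := ⟨p - 1, by omega⟩
  refine ⟨fun k => (k.factorial : ℝ)⁻¹ * iteratedDerivWithin k v (Set.Icc (-1) 1) (-1), fun x hx => ?_⟩
  have h := taylor_mean_remainder_bound (f := v) (a := -1) (b := 1) (C := 1) (n := n) (by norm_num)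
    (by exact_mod_cast hv.contDiffOn) hx (fun y hy => by
      rw [iteratedDerivWithin_eq_iteratedDeriv (uniqueDiffOn_Icc (by norm_num)) _ hy]
      · exact hb y
      · exact_mod_cast hv.contDiffAt)
  rw [taylor_within_apply] at h
  simp only [sub_neg_eq_add, smul_eq_mul] at h
  have e : (∑ k ∈ Finset.range (n + 1), (k.factorial : ℝ)⁻¹ * iteratedDerivWithin k v (Set.Icc (-1) 1) (-1) * (x + 1) ^ k)
    = ∑ k ∈ Finset.range (n + 1), (k.factorial : ℝ)⁻¹ * (x + 1) ^ k * iteratedDerivWithin k v (Set.Icc (-1) 1) (-1) :=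
    Finset.sum_congr rfl fun k _ => by ring
  rw [e]
  refine h.trans ?_
  have h1 : (1 : ℝ) ≤ (n.factorial : ℝ) := by exact_mod_cast Nat.factorial_pos n
  have hx1 : 0 ≤ x + 1 := by linarith [hx.1]
  rw [one_mul]
  refine (div_le_self (by positivity) h1).trans ?_
  have : x + 1 ≤ 2 := by linarith [hx.2]
  gcongr

theorem zolR_bound {d p : ℕ} (hp : 1 ≤ p) {μ ν : Measure (EuclideanSpace ℝ (Fin d))}
    [IsProbabilityMeasure μ] [IsProbabilityMeasure ν]
    (hμ : ∀ᵐ x ∂μ, ‖x‖ ≤ 1) (hν : ∀ᵐ x ∂ν, ‖x‖ ≤ 1)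
    (hm : ∀ α : Fin d → ℕ, (∑ i, α i) ≤ p - 1 →
        (∫ x, ∏ i, x i ^ α i ∂μ) = ∫ x, ∏ i, x i ^ α i ∂ν) (θ : EuclideanSpace ℝ (Fin d)) (hθ : ‖θ‖ = 1)
    {v : ℝ → ℝ} (hv : ContDiff ℝ (p : ℕ∞) v) (hb : ∀ t, |iteratedDeriv p v t| ≤ 1) :
    |(∫ x, v ⟪x, θ⟫ ∂μ) - ∫ x, v ⟪x, θ⟫ ∂ν| ≤ 2 * 2 ^ p := by
  obtain ⟨c, hc⟩ := taylor1 hp hv hb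
  have hvc : Continuous v := hv.continuous
  have hin : ∀ x : EuclideanSpace ℝ (Fin d), ‖x‖ ≤ 1 → ⟪x, θ⟫ ∈ Set.Icc (-1 : ℝ) 1 := by
    intro x hx
    have := abs_real_inner_le_norm x θ
    rw [hθ, mul_one] at this
    exact abs_le.1 (this.trans hx)
  have hT : (∫ x, ∑ k ∈ Finset.range p, c k * (⟪x, θ⟫ + 1) ^ k ∂μ) =
      ∫ x, ∑ k ∈ Finset.range p, c k * (⟪x, θ⟫ + 1) ^ k ∂ν := by
    rw [integral_finsetSum, integral_finsetSum]
    · refine Finset.sum_congr rfl fun k hk => ?_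
      rw [integral_const_mul, integral_const_mul, inner_moment hμ hν hm θ k (Finset.mem_range.1 hk)]
    · intro I _
      exact ball_integrable hν (by fun_prop)
    · intro I _
      exact ball_integrable hμ (by fun_prop)
  have hone : ∀ (ρ : Measure (EuclideanSpace ℝ (Fin d))) [IsProbabilityMeasure ρ], (∀ᵐ x ∂ρ, ‖x‖ ≤ 1) →
      |(∫ x, v ⟪x, θ⟫ ∂ρ) - ∫ x, ∑ k ∈ Finset.range p, c k * (⟪x, θ⟫ + 1) ^ k ∂ρ| ≤ 2 ^ p := by
    intro ρ _ hρ
    rw [← integral_sub (ball_integrable hρ (by fun_prop)) (ball_integrable hρ (by fun_prop))]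
    have := norm_integral_le_of_norm_le_const (μ := ρ) (C := 2 ^ p)
      (f := fun x => v ⟪x, θ⟫ - ∑ k ∈ Finset.range p, c k * (⟪x, θ⟫ + 1) ^ k) (by
        filter_upwards [hρ] with x hx
        exact hc _ (hin x hx))
    simpa using this
  have h1 := abs_le.1 (hone μ hμ)
  have h2 := abs_le.1 (hone ν hν)
  rw [hT] at h1
  rw [abs_le]
  constructor <;> linarith [h1.1, h1.2, h2.1, h2.2]

/-- the supremum over directions -/
def zolSup {d : ℕ} (p : ℕ) (μ ν : Measure (EuclideanSpace ℝ (Fin d))) : ℝ :=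
  (⨆ θ : Metric.sphere (0 : EuclideanSpace ℝ (Fin d)) 1,
            zolotarevDistR p (μ.map (fun x => ⟪x, (θ : EuclideanSpace ℝ (Fin d))⟫))
              (ν.map (fun x => ⟪x, (θ : EuclideanSpace ℝ (Fin d))⟫)))

theorem zolSup_nonneg {d : ℕ} (p : ℕ) (μ ν : Measure (EuclideanSpace ℝ (Fin d))) : 0 ≤ zolSup p μ ν := by
  refine Real.iSup_nonneg fun θ => Real.sSup_nonneg ?_
  rintro z ⟨v, -, -, rfl⟩
  exact abs_nonneg _

theorem le_zolSup {d p : ℕ} (hp : 1 ≤ p) {μ ν : Measure (EuclideanSpace ℝ (Fin d))}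
    [IsProbabilityMeasure μ] [IsProbabilityMeasure ν]
    (hμ : ∀ᵐ x ∂μ, ‖x‖ ≤ 1) (hν : ∀ᵐ x ∂ν, ‖x‖ ≤ 1)
    (hm : ∀ α : Fin d → ℕ, (∑ i, α i) ≤ p - 1 →
        (∫ x, ∏ i, x i ^ α i ∂μ) = ∫ x, ∏ i, x i ^ α i ∂ν) (θ : EuclideanSpace ℝ (Fin d)) (hθ : ‖θ‖ = 1)
    {v : ℝ → ℝ} (hv : ContDiff ℝ (p : ℕ∞) v) (hb : ∀ t, |iteratedDeriv p v t| ≤ 1) :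
    |(∫ x, v ⟪x, θ⟫ ∂μ) - ∫ x, v ⟪x, θ⟫ ∂ν| ≤ zolSup p μ ν := by
  have hmap : ∀ (ρ : Measure (EuclideanSpace ℝ (Fin d))) (θ : EuclideanSpace ℝ (Fin d)) (v : ℝ → ℝ),
      ContDiff ℝ (p : ℕ∞) v → ∫ s, v s ∂(ρ.map (fun x => ⟪x, θ⟫)) = ∫ x, v ⟪x, θ⟫ ∂ρ := by
    intro ρ θ v hv
    rw [integral_map (by fun_prop) hv.continuous.aestronglyMeasurable]
  have hbd : ∀ θ : Metric.sphere (0 : EuclideanSpace ℝ (Fin d)) 1,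
      ∀ z ∈ { z | ∃ v : ℝ → ℝ, ContDiff ℝ (p : ℕ∞) v ∧ (∀ t, |iteratedDeriv p v t| ≤ 1) ∧
      z = |(∫ x, v x ∂(μ.map (fun x => ⟪x, (θ : EuclideanSpace ℝ (Fin d))⟫))) -
        ∫ x, v x ∂(ν.map (fun x => ⟪x, (θ : EuclideanSpace ℝ (Fin d))⟫))| }, z ≤ 2 * 2 ^ p := by
    rintro θ z ⟨v, hv, hb, rfl⟩
    rw [hmap _ _ _ hv, hmap _ _ _ hv]
    exact zolR_bound hp hμ hν hm θ (by simp) hv hb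
  have h1 : zolotarevDistR p (μ.map (fun x => ⟪x, θ⟫)) (ν.map (fun x => ⟪x, θ⟫)) ≤ zolSup p μ ν := by
    refine le_ciSup (f := fun θ : Metric.sphere (0 : EuclideanSpace ℝ (Fin d)) 1 =>
      zolotarevDistR p (μ.map (fun x => ⟪x, (θ : EuclideanSpace ℝ (Fin d))⟫))
              (ν.map (fun x => ⟪x, (θ : EuclideanSpace ℝ (Fin d))⟫))) ?_ ⟨θ, by simpa using hθ⟩
    refine ⟨2 * 2 ^ p, ?_⟩
    rintro _ ⟨θ, rfl⟩
    exact Real.sSup_le (hbd θ) (by positivity)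
  refine le_trans ?_ h1
  refine le_csSup ⟨2 * 2 ^ p, hbd ⟨θ, by simpa using hθ⟩⟩ ⟨v, hv, hb, ?_⟩
  rw [hmap _ _ _ hv, hmap _ _ _ hv]

theorem trig_bound (n : ℕ) : (∀ t, |iteratedDeriv n Real.cos t| ≤ 1) ∧ (∀ t, |iteratedDeriv n Real.sin t| ≤ 1) := by
  induction n with
  | zero => simp [Real.abs_cos_le_one, Real.abs_sin_le_one]
  | succ n ih => 
    refine ⟨fun t => ?_, fun t => ?_⟩
    · rw [Real.iteratedDeriv_add_one_cos]
      simpa using ih.2 t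
    · rw [Real.iteratedDeriv_add_one_sin]
      exact ih.1 t

theorem char_bound {d p : ℕ} (hp : 1 ≤ p) {μ ν : Measure (EuclideanSpace ℝ (Fin d))}
    [IsProbabilityMeasure μ] [IsProbabilityMeasure ν]
    (hμ : ∀ᵐ x ∂μ, ‖x‖ ≤ 1) (hν : ∀ᵐ x ∂ν, ‖x‖ ≤ 1)
    (hm : ∀ α : Fin d → ℕ, (∑ i, α i) ≤ p - 1 →
        (∫ x, ∏ i, x i ^ α i ∂μ) = ∫ x, ∏ i, x i ^ α i ∂ν) (t : EuclideanSpace ℝ (Fin d)) :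
    ‖(∫ x, ee ⟪t, x⟫ ∂μ) - ∫ x, ee ⟪t, x⟫ ∂ν‖ ≤ 2 * zolSup p μ ν * (2 * Real.pi * ‖t‖) ^ p := by
  have hM := zolSup_nonneg p μ ν
  rcases eq_or_ne t 0 with rfl | ht
  · simp [ee]
    positivity
  have htn : 0 < ‖t‖ := norm_pos_iff.2 ht
  set l := 2 * Real.pi * ‖t‖ with hl
  have hlp : 0 < l := by positivity
  have key : ∀ f : ℝ → ℝ, ContDiff ℝ (p : ℕ∞) f → (∀ t, |iteratedDeriv p f t| ≤ 1) →
      |(∫ x, f (2 * Real.pi * ⟪t, x⟫) ∂μ) - ∫ x, f (2 * Real.pi * ⟪t, x⟫) ∂ν| ≤ zolSup p μ ν * l ^ p := by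
    intro f hf hfb
    have h := le_zolSup hp hμ hν hm (‖t‖⁻¹ • t) (by rw [norm_smul]; simp [htn.ne'])
      (v := fun s => (l ^ p)⁻¹ * f (l * s)) (contDiff_const.mul (hf.comp (contDiff_const.mul contDiff_id)))
      (fun s => by
        rw [iteratedDeriv_const_mul_field, iteratedDeriv_comp_const_mul (by exact_mod_cast hf)]
        simp only
        rw [← mul_assoc, inv_mul_cancel₀ (by positivity), one_mul]
        exact hfb _)
    rw [integral_const_mul, integral_const_mul, ← mul_sub, abs_mul, abs_of_pos (by positivity),
      inv_mul_le_iff₀ (by positivity), mul_comm] at h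
    have e : ∀ x : EuclideanSpace ℝ (Fin d), l * ⟪x, ‖t‖⁻¹ • t⟫ = 2 * Real.pi * ⟪t, x⟫ := by
      intro x
      rw [real_inner_smul_right, hl, real_inner_comm]
      field_simp
    simpa only [e] using h
  have hs : ∀ (ρ : Measure (EuclideanSpace ℝ (Fin d))) [IsProbabilityMeasure ρ], (∀ᵐ x ∂ρ, ‖x‖ ≤ 1) →
      ∫ x, ee ⟪t, x⟫ ∂ρ = ((∫ x, Real.cos (2 * Real.pi * ⟪t, x⟫) ∂ρ : ℝ) : ℂ) +
        ((∫ x, Real.sin (2 * Real.pi * ⟪t, x⟫) ∂ρ : ℝ) : ℂ) * Complex.I := by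
    intro ρ _ hρ
    rw [← integral_complex_ofReal, ← integral_complex_ofReal, ← integral_mul_const, ← integral_add]
    · congr 1; funext x
      unfold ee
      rw [Complex.exp_mul_I]
      push_cast
      rfl
    · exact ball_integrable hρ (by fun_prop)
    · exact ball_integrable hρ (by fun_prop)
  rw [hs μ hμ, hs ν hν]
  have h1 := key Real.cos Real.contDiff_cos (trig_bound p).1
  have h2 := key Real.sin Real.contDiff_sin (trig_bound p).2
  rw [add_sub_add_comm, ← sub_mul, ← Complex.ofReal_sub, ← Complex.ofReal_sub]
  refine (norm_add_le _ _).trans ?_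
  rw [norm_mul, Complex.norm_I, mul_one, Complex.norm_real, Complex.norm_real, Real.norm_eq_abs, Real.norm_eq_abs]
  linarith


section FT9
open scoped FourierTransform SchwartzMap

def gg {d : ℕ} (σ : ℝ) (t : EuclideanSpace ℝ (Fin d)) : ℝ := Real.exp (-(2 * Real.pi ^ 2 * σ ^ 2 * ‖t‖ ^ 2))

def mm {d : ℕ} (σ : ℝ) (p : ℕ) (t : EuclideanSpace ℝ (Fin d)) : ℝ := 1 - (1 - gg σ t) ^ p

theorem gg_le {d : ℕ} (σ : ℝ) (t : EuclideanSpace ℝ (Fin d)) : gg σ t ≤ 1 := by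
  unfold gg
  rw [Real.exp_le_one_iff]
  have : 0 ≤ 2 * Real.pi ^ 2 * σ ^ 2 * ‖t‖ ^ 2 := by positivity
  linarith

theorem gg_pos {d : ℕ} (σ : ℝ) (t : EuclideanSpace ℝ (Fin d)) : 0 < gg σ t := by
  exact Real.exp_pos _

theorem mm_nonneg {d : ℕ} (σ : ℝ) (p : ℕ) (t : EuclideanSpace ℝ (Fin d)) : 0 ≤ mm σ p t := by
  unfold mm
  have := pow_le_one₀ (n := p) (sub_nonneg.2 (gg_le σ t)) (by linarith [gg_pos σ t])
  linarith

theorem mm_le_one {d : ℕ} (σ : ℝ) (p : ℕ) (t : EuclideanSpace ℝ (Fin d)) : mm σ p t ≤ 1 := by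
  unfold mm
  have := pow_nonneg (sub_nonneg.2 (gg_le σ t)) p
  linarith

theorem mm_le {d : ℕ} (σ : ℝ) (p : ℕ) (t : EuclideanSpace ℝ (Fin d)) : mm σ p t ≤ p * gg σ t := by
  unfold mm
  have := one_add_mul_le_pow (a := - gg σ t) (by linarith [gg_le σ t]) p
  rw [← sub_eq_add_neg] at this
  linarith

theorem gg_cont {d : ℕ} (σ : ℝ) : Continuous (gg σ : EuclideanSpace ℝ (Fin d) → ℝ) := by
  unfold gg
  fun_prop

theorem mm_cont {d : ℕ} (σ : ℝ) (p : ℕ) : Continuous (mm σ p : EuclideanSpace ℝ (Fin d) → ℝ) := by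
  unfold mm
  have := gg_cont (d := d) σ
  fun_prop

theorem band_prod {d : ℕ} {b : EuclideanSpace ℝ (Fin d) → ℂ} (hb : Integrable b)
    (ρ : Measure (EuclideanSpace ℝ (Fin d))) [IsProbabilityMeasure ρ] :
    Integrable (fun z : EuclideanSpace ℝ (Fin d) × EuclideanSpace ℝ (Fin d) => b z.2 * ee ⟪z.2, z.1⟫) (ρ.prod volume) := by
  refine (hb.comp_snd ρ).mul_bdd (c := 1) ?_ (Filter.Eventually.of_forall fun z => (norm_ee _).le)
  have : Continuous fun z : EuclideanSpace ℝ (Fin d) × EuclideanSpace ℝ (Fin d) => ee ⟪z.2, z.1⟫ :=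
    continuous_ee.comp (by fun_prop)
  exact this.aestronglyMeasurable

theorem band_int {d : ℕ} {b : EuclideanSpace ℝ (Fin d) → ℂ} (hb : Integrable b)
    (ρ : Measure (EuclideanSpace ℝ (Fin d))) [IsProbabilityMeasure ρ] : Integrable (𝓕⁻ b) ρ := by
  have := (band_prod hb ρ).integral_prod_left
  refine this.congr (Filter.Eventually.of_forall fun x => ?_)
  rw [fourierInv_eq']

theorem band_eq {d : ℕ} {b : EuclideanSpace ℝ (Fin d) → ℂ} (hb : Integrable b)
    (ρ : Measure (EuclideanSpace ℝ (Fin d))) [IsProbabilityMeasure ρ] :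
    ∫ x, 𝓕⁻ b x ∂ρ = ∫ t, b t * ∫ x, ee ⟪t, x⟫ ∂ρ := by
  simp_rw [fourierInv_eq']
  rw [integral_integral_swap (band_prod hb ρ)]
  congr 1; funext t
  rw [integral_const_mul]

theorem char_meas {d : ℕ} (ρ : Measure (EuclideanSpace ℝ (Fin d))) [IsProbabilityMeasure ρ] :
    Continuous (fun t => ∫ x, ee ⟪t, x⟫ ∂ρ) := by
  refine continuous_of_dominated (bound := fun _ => 1) ?_ ?_ (integrable_const _) ?_
  · intro t
    exact (continuous_ee.comp (by fun_prop)).aestronglyMeasurable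
  · intro t
    exact Filter.Eventually.of_forall fun x => (norm_ee _).le
  · exact Filter.Eventually.of_forall fun x => continuous_ee.comp (by fun_prop)

theorem char_le {d : ℕ} (ρ : Measure (EuclideanSpace ℝ (Fin d))) [IsProbabilityMeasure ρ] (t : EuclideanSpace ℝ (Fin d)) :
    ‖∫ x, ee ⟪t, x⟫ ∂ρ‖ ≤ 1 := by
  have := norm_integral_le_of_norm_le_const (μ := ρ) (C := 1) (f := fun x => ee ⟪t, x⟫)
    (Filter.Eventually.of_forall fun x => (norm_ee _).le)
  simpa using this

theorem cs {d : ℕ} {F G : EuclideanSpace ℝ (Fin d) → ℝ} (hF : Continuous F) (hG : Continuous G)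
    (hF0 : ∀ t, 0 ≤ F t) (hG0 : ∀ t, 0 ≤ G t)
    (hF2 : Integrable fun t => F t ^ 2) (hG2 : Integrable fun t => G t ^ 2) :
    Integrable (fun t => F t * G t) ∧ ∫ t, F t * G t ≤ √(∫ t, F t ^ 2) * √(∫ t, G t ^ 2) := by
  have h1 : MemLp F 2 := (memLp_two_iff_integrable_sq hF.aestronglyMeasurable).2 hF2
  have h2 : MemLp G 2 := (memLp_two_iff_integrable_sq hG.aestronglyMeasurable).2 hG2
  refine ⟨h1.integrable_mul h2, ?_⟩
  have := integral_mul_le_Lp_mul_Lq_of_nonneg (μ := volume) (p := 2) (q := 2) (f := F) (g := G)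
    ⟨by norm_num, by norm_num, by norm_num⟩ (Filter.Eventually.of_forall hF0) (Filter.Eventually.of_forall hG0)
    (by simpa using h1) (by simpa using h2)
  rw [Real.sqrt_eq_rpow, Real.sqrt_eq_rpow]
  simpa using this

theorem gg_sq_int {d : ℕ} {σ : ℝ} (hσ : 0 < σ) :
    Integrable (fun t : EuclideanSpace ℝ (Fin d) => gg σ t ^ 2) ∧
    ∫ t : EuclideanSpace ℝ (Fin d), gg σ t ^ 2 = (Real.pi / (4 * Real.pi ^ 2 * σ ^ 2)) ^ ((d : ℝ) / 2) := by
  have e : ∀ t : EuclideanSpace ℝ (Fin d), gg σ t ^ 2 = Real.exp (-(4 * Real.pi ^ 2 * σ ^ 2) * ‖t‖ ^ 2) := by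
    intro t
    unfold gg
    rw [← Real.exp_nat_mul]
    congr 1
    push_cast
    ring
  simp_rw [e]
  have h := GaussianFourier.integral_rexp_neg_mul_sq_norm (V := EuclideanSpace ℝ (Fin d))
    (b := 4 * Real.pi ^ 2 * σ ^ 2) (by positivity)
  rw [finrank_euclideanSpace_fin] at h
  refine ⟨?_, h⟩
  by_contra hn
  rw [integral_undef hn] at h
  have : 0 < (Real.pi / (4 * Real.pi ^ 2 * σ ^ 2)) ^ ((d : ℝ) / 2) := by positivity
  linarith

theorem gg_sq_bound {d : ℕ} {σ : ℝ} (hσ : 0 < σ) :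
    √(∫ t : EuclideanSpace ℝ (Fin d), gg σ t ^ 2) ≤ σ ^ (-((d : ℝ) / 2)) := by
  rw [(gg_sq_int hσ).2]
  apply Real.sqrt_le_iff.2
  refine ⟨by positivity, ?_⟩
  have h1 : (σ ^ (-((d : ℝ) / 2))) ^ 2 = (1 / σ ^ 2) ^ ((d : ℝ) / 2) := by
    rw [← Real.rpow_natCast, ← Real.rpow_mul hσ.le, one_div, Real.inv_rpow (by positivity), 
      ← Real.rpow_natCast σ 2, ← Real.rpow_mul hσ.le, ← Real.rpow_neg hσ.le]
    congr 1
    push_cast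
    ring
  rw [h1]
  refine Real.rpow_le_rpow (by positivity) ?_ (by positivity)
  rw [div_le_div_iff₀ (by positivity) (by positivity)]
  have := Real.pi_gt_three
  have h3 : 0 < σ ^ 2 := by positivity
  nlinarith [mul_pos h3 Real.pi_pos, mul_pos (mul_pos h3 Real.pi_pos) Real.pi_pos]

theorem band {d p : ℕ} (hp : 1 ≤ p) {μ ν : Measure (EuclideanSpace ℝ (Fin d))}
    [IsProbabilityMeasure μ] [IsProbabilityMeasure ν]
    (hμ : ∀ᵐ x ∂μ, ‖x‖ ≤ 1) (hν : ∀ᵐ x ∂ν, ‖x‖ ≤ 1)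
    (hm : ∀ α : Fin d → ℕ, (∑ i, α i) ≤ p - 1 →
        (∫ x, ∏ i, x i ^ α i ∂μ) = ∫ x, ∏ i, x i ^ α i ∂ν) {σ : ℝ} (hσ : 0 < σ)
    (a : 𝓢(EuclideanSpace ℝ (Fin d), ℂ)) (A : ℝ) (hA0 : 0 ≤ A)
    (hA : ∫ t, (2 * Real.pi * ‖t‖) ^ (2 * p) * ‖a t‖ ^ 2 ≤ A ^ 2) :
    ‖(∫ x, 𝓕⁻ (fun t => a t * (mm σ p t : ℂ)) x ∂μ) - ∫ x, 𝓕⁻ (fun t => a t * (mm σ p t : ℂ)) x ∂ν‖ ≤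
      2 * zolSup p μ ν * p * (A * σ ^ (-((d : ℝ) / 2))) := by
  have hM := zolSup_nonneg p μ ν
  have hgc := gg_cont (d := d) σ
  have hmc := mm_cont (d := d) σ p
  have hb : Integrable (fun t => a t * (mm σ p t : ℂ)) :=
    fourierInv_int a.integrable (by fun_prop) 1 (fun t => by
      rw [Complex.norm_real, Real.norm_of_nonneg (mm_nonneg σ p t)]
      exact mm_le_one σ p t)
  rw [band_eq hb, band_eq hb, ← integral_sub (fourierInv_int hb (char_meas μ) 1 (char_le μ))
    (fourierInv_int hb (char_meas ν) 1 (char_le ν))]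
  have hF2 : Integrable fun t => ((2 * Real.pi * ‖t‖) ^ p * ‖a t‖) ^ 2 := by
    refine ((schwartz_int a (2 * p)).const_mul ((2 * Real.pi) ^ (2 * p))).congr (Filter.Eventually.of_forall fun t => ?_)
    simp only [mul_pow]
    ring
  obtain ⟨hi, hcs⟩ := cs (d := d) (F := fun t => (2 * Real.pi * ‖t‖) ^ p * ‖a t‖) (G := gg σ) (by fun_prop) hgc
    (fun t => by positivity) (fun t => (gg_pos σ t).le) hF2 (gg_sq_int hσ).1
  have hAle : √(∫ t, ((2 * Real.pi * ‖t‖) ^ p * ‖a t‖) ^ 2) ≤ A := by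
    apply Real.sqrt_le_iff.2 ⟨hA0, ?_⟩
    refine le_trans (le_of_eq ?_) hA
    congr 1; funext t
    ring
  calc _ ≤ ∫ t, (2 * zolSup p μ ν * p) * ((2 * Real.pi * ‖t‖) ^ p * ‖a t‖ * gg σ t) := by
        refine norm_integral_le_of_norm_le (hi.const_mul _) (Filter.Eventually.of_forall fun t => ?_)
        rw [← mul_sub, norm_mul, norm_mul, Complex.norm_real, Real.norm_of_nonneg (mm_nonneg σ p t)]
        have h1 := char_bound hp hμ hν hm t
        have h2 := mm_le σ p t
        have h3 := mm_nonneg σ p t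
        calc _ ≤ ‖a t‖ * (p * gg σ t) * (2 * zolSup p μ ν * (2 * Real.pi * ‖t‖) ^ p) := by
              gcongr
              exact mul_nonneg (norm_nonneg _) (h3.trans h2)
          _ = _ := by ring
    _ = (2 * zolSup p μ ν * p) * ∫ t, (2 * Real.pi * ‖t‖) ^ p * ‖a t‖ * gg σ t := integral_const_mul _ _
    _ ≤ _ := by
        gcongr
        refine hcs.trans ?_
        exact mul_le_mul hAle (gg_sq_bound hσ) (Real.sqrt_nonneg _) hA0

theorem main_bound {d p : ℕ} (hp : 1 ≤ p) {μ ν : Measure (EuclideanSpace ℝ (Fin d))}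
    [IsProbabilityMeasure μ] [IsProbabilityMeasure ν]
    (hμ : ∀ᵐ x ∂μ, ‖x‖ ≤ 1) (hν : ∀ᵐ x ∂ν, ‖x‖ ≤ 1)
    (hm : ∀ α : Fin d → ℕ, (∑ i, α i) ≤ p - 1 →
        (∫ x, ∏ i, x i ^ α i ∂μ) = ∫ x, ∏ i, x i ^ α i ∂ν) {σ : ℝ} (hσ : 0 < σ)
    {u : EuclideanSpace ℝ (Fin d) → ℝ} (hu : ContDiff ℝ (⊤ : ℕ∞) u)
    (hmd : ∀ α : Fin d → ℕ, (∑ i, α i) = p → ∀ x, |mderiv α u x| ≤ 1) :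
    |(∫ x, u x ∂μ) - ∫ x, u x ∂ν| ≤
      2 * (33 * d) ^ p * (σ ^ p + zolSup p μ ν * p * 2 ^ d * σ ^ (-((d : ℝ) / 2))) := by
  obtain ⟨w, hw, hwu, hw0, hwK⟩ := exists_cutoff hu p hp ((√d) ^ p) (opnorm_of_mderiv hu hmd)
  set K : ℝ := (√d) ^ p * 33 ^ p with hKdef
  have hK0 : 0 ≤ K := by positivity
  have hcs : HasCompactSupport (fun x => (w x : ℂ)) := by
    refine HasCompactSupport.intro (isCompact_closedBall (0 : EuclideanSpace ℝ (Fin d)) 2) fun x hx => ?_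
    have : 2 ≤ ‖x‖ := by
      have : ¬ ‖x‖ ≤ 2 := by simpa using hx
      linarith
    simp [hw0 x this]
  have hsm : ContDiff ℝ (⊤ : ℕ∞) (fun x => (w x : ℂ)) := Complex.ofRealCLM.contDiff.comp hw
  let f : 𝓢(EuclideanSpace ℝ (Fin d), ℂ) := hcs.toSchwartzMap hsm
  have hf : ∀ x, f x = (w x : ℂ) := fun x => rfl
  have hfw : (f : EuclideanSpace ℝ (Fin d) → ℂ) = fun x => (w x : ℂ) := rfl
  have hfK : ∀ x, ‖iteratedFDeriv ℝ p f x‖ ≤ K := by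
    intro x
    rw [hfw]
    have := Complex.ofRealLI.norm_iteratedFDeriv_comp_left (f := w) (x := x) (n := p) (i := p)
      (hw.of_le (by exact_mod_cast le_top)).contDiffAt le_rfl
    have h2 := hwK x
    rw [← this] at h2
    exact h2
  have hfs : tsupport f ⊆ Metric.closedBall 0 2 := by
    refine closure_minimal ?_ Metric.isClosed_closedBall
    intro x hx
    by_contra hn
    apply hx
    have : 2 ≤ ‖x‖ := by
      have : ¬ ‖x‖ ≤ 2 := by simpa using hn
      linarith
    simp [hf, hw0 x this]
  obtain ⟨F, hF⟩ : ∃ F : 𝓢(EuclideanSpace ℝ (Fin d), ℂ), F = 𝓕 f := ⟨_, rfl⟩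
  have hA : ∫ t, (2 * Real.pi * ‖t‖) ^ (2 * p) * ‖F t‖ ^ 2 ≤ ((33 * (d : ℝ)) ^ p * 2 ^ d) ^ 2 := by
    rw [hF]
    refine (plancherel_bound p f K hfK hfs).trans ?_
    calc _ ≤ (d : ℝ) ^ p * (K ^ 2 * 4 ^ d) := by
          gcongr
          exact vol_bound d
      _ = _ := by
        have e1 : K ^ 2 = (d : ℝ) ^ p * (33 ^ p) ^ 2 := by
          rw [hKdef, mul_pow, ← pow_mul, mul_comm p 2, pow_mul, Real.sq_sqrt (by positivity)]
        have e2 : (4 : ℝ) ^ d = (2 ^ d) ^ 2 := by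
          rw [← pow_mul, mul_comm d 2, pow_mul]; norm_num
        rw [e1, e2, mul_pow 33]
        ring
  have hinv : 𝓕⁻ (F : EuclideanSpace ℝ (Fin d) → ℂ) = f := by
    rw [← SchwartzMap.fourierInv_coe, hF, FourierTransform.fourierInv_fourier_eq]
  have hband := band hp hμ hν hm hσ F ((33 * d) ^ p * 2 ^ d) (by positivity) hA
  set b := 𝓕⁻ (fun t => F t * (mm σ p t : ℂ)) with hbdef
  have hmc := mm_cont (d := d) σ p
  have hgc := gg_cont (d := d) σ
  have hbi : Integrable (fun t => F t * (mm σ p t : ℂ)) :=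
    fourierInv_int F.integrable (by fun_prop) 1 (fun t => by
      rw [Complex.norm_real, Real.norm_of_nonneg (mm_nonneg σ p t)]
      exact mm_le_one σ p t)
  have herr : ∀ x, ‖f x - b x‖ ≤ (σ * √d) ^ p * K := by
    intro x
    have h1 := smoothing σ hσ p F K hK0 F.integrable (by rw [hinv]; exact f.smooth') (by rw [hinv]; exact hfK) x
    convert h1 using 2
    have h2 : f x = 𝓕⁻ (F : EuclideanSpace ℝ (Fin d) → ℂ) x := by rw [hinv]
    rw [h2, hbdef, fourierInv_eq', fourierInv_eq', fourierInv_eq', ← integral_sub]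
    · congr 1; funext t
      unfold mm gg
      push_cast
      ring
    · exact fourierInv_int F.integrable (char_cont _) 1 (fun _ => (norm_ee _).le)
    · exact fourierInv_int hbi (char_cont _) 1 (fun _ => (norm_ee _).le)
  have hone : ∀ (ρ : Measure (EuclideanSpace ℝ (Fin d))) [IsProbabilityMeasure ρ], (∀ᵐ x ∂ρ, ‖x‖ ≤ 1) →
      ‖((∫ x, (u x - tpol u p x) ∂ρ : ℝ) : ℂ) - ∫ x, b x ∂ρ‖ ≤ (σ * √d) ^ p * K := by
    intro ρ _ hρ
    have e : ((∫ x, (u x - tpol u p x) ∂ρ : ℝ) : ℂ) = ∫ x, f x ∂ρ := by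
      rw [← integral_complex_ofReal]
      refine integral_congr_ae ?_
      filter_upwards [hρ] with x hx
      rw [hf, hwu x hx]
    rw [e, ← integral_sub (ball_integrable hρ f.continuous) (band_int hbi ρ)]
    have := norm_integral_le_of_norm_le_const (μ := ρ) (Filter.Eventually.of_forall herr)
    simpa using this
  have hdiff : (∫ x, u x ∂μ) - ∫ x, u x ∂ν = (∫ x, (u x - tpol u p x) ∂μ) - ∫ x, (u x - tpol u p x) ∂ν := by
    have hc := (tpol_contDiff u p).continuous
    rw [integral_sub (ball_integrable hμ hu.continuous) (ball_integrable hμ hc),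
      integral_sub (ball_integrable hν hu.continuous) (ball_integrable hν hc), tpol_moment hμ hν hm u]
    ring
  rw [hdiff, ← Real.norm_eq_abs, ← Complex.norm_real, Complex.ofReal_sub]
  have h1 := hone μ hμ
  have h2 := hone ν hν
  set X := ((∫ x, (u x - tpol u p x) ∂μ : ℝ) : ℂ)
  set Y := ((∫ x, (u x - tpol u p x) ∂ν : ℝ) : ℂ)
  have h3 : ‖X - Y‖ ≤ ‖X - ∫ x, b x ∂μ‖ + ‖(∫ x, b x ∂μ) - ∫ x, b x ∂ν‖ + ‖Y - ∫ x, b x ∂ν‖ := by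
    rw [norm_sub_rev Y]
    have : X - Y = (X - ∫ x, b x ∂μ) + ((∫ x, b x ∂μ) - ∫ x, b x ∂ν) + ((∫ x, b x ∂ν) - Y) := by ring
    rw [this]
    exact norm_add₃_le
  have e3 : (σ * √d) ^ p * K = σ ^ p * (33 * d) ^ p := by
    rw [hKdef]
    have : (√d : ℝ) * √d = d := Real.mul_self_sqrt (by positivity)
    calc _ = σ ^ p * (33 * (√d * √d)) ^ p := by
          simp only [mul_pow]; ring
      _ = _ := by rw [this]
  rw [e3] at h1 h2
  calc _ ≤ _ := h3
    _ ≤ σ ^ p * (33 * d) ^ p + 2 * zolSup p μ ν * p * (((33 * d) ^ p * 2 ^ d) * σ ^ (-((d : ℝ) / 2))) + σ ^ p * (33 * d) ^ p := by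
      gcongr
    _ = _ := by ring

end FT9


theorem opt_bound {d p : ℕ} (hp : 1 ≤ p) {M X : ℝ} (hM : 0 ≤ M)
    (h : ∀ σ : ℝ, 0 < σ → X ≤ 2 * (33 * d) ^ p * (σ ^ p + M * p * 2 ^ d * σ ^ (-((d : ℝ) / 2)))) :
    X ≤ (528 * d) ^ p * M ^ (2 / (2 + (d : ℝ) / (p : ℝ))) := by
  have hp0 : (0 : ℝ) < p := by exact_mod_cast hp
  have hd0 : (0 : ℝ) ≤ d := by positivity
  rcases hM.eq_or_lt with h0 | hM
  · rw [← h0, Real.zero_rpow (by positivity), mul_zero]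
    have hlim : Filter.Tendsto (fun σ : ℝ => 2 * (33 * (d : ℝ)) ^ p * σ ^ p) (nhdsWithin 0 (Set.Ioi 0)) (nhds 0) := by
      have : Continuous (fun σ : ℝ => 2 * (33 * (d : ℝ)) ^ p * σ ^ p) := by fun_prop
      have h2 := this.tendsto 0
      rw [zero_pow (by omega), mul_zero] at h2
      exact h2.mono_left nhdsWithin_le_nhds
    refine ge_of_tendsto hlim ?_
    filter_upwards [self_mem_nhdsWithin] with σ hσ
    have := h σ hσ
    rw [← h0] at this
    simpa using this
  · set s : ℝ := p + d / 2 with hs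
    have hs0 : 0 < s := by positivity
    set Q : ℝ := 2 ^ d * M with hQ
    have hQ0 : 0 < Q := by positivity
    have hβ : 2 / (2 + (d : ℝ) / (p : ℝ)) = p / s := by
      rw [hs]; field_simp
    have e1 : (Q ^ (1 / s)) ^ p = Q ^ ((p : ℝ) / s) := by
      rw [← Real.rpow_natCast, ← Real.rpow_mul hQ0.le]
      congr 1; ring
    have e2 : Q * (Q ^ (1 / s)) ^ (-((d : ℝ) / 2)) = Q ^ ((p : ℝ) / s) := by
      rw [← Real.rpow_mul hQ0.le]
      nth_rewrite 1 [← Real.rpow_one Q]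
      rw [← Real.rpow_add hQ0]
      congr 1
      field_simp
      rw [hs]; ring
    have h1 := h (Q ^ (1 / s)) (by positivity)
    have e3 : (Q ^ (1 / s)) ^ p + M * p * 2 ^ d * (Q ^ (1 / s)) ^ (-((d : ℝ) / 2)) = (1 + p) * Q ^ ((p : ℝ) / s) := by
      have : M * p * 2 ^ d * (Q ^ (1 / s)) ^ (-((d : ℝ) / 2)) = p * (Q * (Q ^ (1 / s)) ^ (-((d : ℝ) / 2))) := by
        rw [hQ]; ring
      rw [this, e1, e2]; ring
    rw [e3] at h1
    have e4 : Q ^ ((p : ℝ) / s) ≤ 4 ^ p * M ^ ((p : ℝ) / s) := by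
      rw [hQ, Real.mul_rpow (by positivity) hM.le]
      gcongr
      rw [← Real.rpow_natCast, ← Real.rpow_mul (by norm_num)]
      have : (4 : ℝ) ^ p = 2 ^ (2 * (p : ℝ)) := by
        rw [Real.rpow_mul (by norm_num), Real.rpow_natCast]; norm_num
      rw [this]
      refine Real.rpow_le_rpow_of_exponent_le (by norm_num) ?_
      rw [mul_div_assoc', div_le_iff₀ hs0, hs]
      nlinarith [mul_pos hp0 hp0]
    have e5 : 2 * (1 + (p : ℝ)) ≤ 4 ^ p := by
      have := one_add_mul_le_pow (a := (3 : ℝ)) (by norm_num) p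
      norm_num at this
      have h1 : (1 : ℝ) ≤ p := by exact_mod_cast hp
      linarith
    rw [hβ]
    calc X ≤ _ := h1
      _ = (33 * d) ^ p * (2 * (1 + p)) * Q ^ ((p : ℝ) / s) := by ring
      _ ≤ (33 * d) ^ p * 4 ^ p * (4 ^ p * M ^ ((p : ℝ) / s)) := by gcongr
      _ = _ := by
        have : (528 * (d : ℝ)) = 33 * d * 4 * 4 := by ring
        rw [this, mul_pow (33 * (d : ℝ) * 4), mul_pow (33 * (d : ℝ))]
        ring


/-- **Cramér–Wold theorem for Zolotarev distances, compactly supported case** (Corollary 1.3).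
If `μ, ν` are probability measures supported on the closed unit ball of `ℝ^d`, having equal
mixed moments up to order `p - 1`, then
`ζ_p(μ,ν) ≤ (c d)^p (sup_{|θ|=1} ζ_p(μ_θ,ν_θ))^β` with `β = 2 / (2 + d/p)`,
for an absolute constant `c > 0`. -/
theorem cramer_wold_zolotarev_ball :
    ∃ c : ℝ, 0 < c ∧ ∀ (d p : ℕ), 1 ≤ p →
    ∀ (μ ν : Measure (EuclideanSpace ℝ (Fin d))),
      IsProbabilityMeasure μ → IsProbabilityMeasure ν →
      μ (Metric.closedBall (0 : EuclideanSpace ℝ (Fin d)) 1) = 1 →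
      ν (Metric.closedBall (0 : EuclideanSpace ℝ (Fin d)) 1) = 1 →
      (∀ α : Fin d → ℕ, (∑ i, α i) ≤ p - 1 →
        (∫ x, ∏ i, x i ^ α i ∂μ) = ∫ x, ∏ i, x i ^ α i ∂ν) →
      zolotarevDist p μ ν ≤
        (c * d) ^ p *
          (⨆ θ : Metric.sphere (0 : EuclideanSpace ℝ (Fin d)) 1,
            zolotarevDistR p (μ.map (fun x => ⟪x, (θ : EuclideanSpace ℝ (Fin d))⟫))
              (ν.map (fun x => ⟪x, (θ : EuclideanSpace ℝ (Fin d))⟫))) ^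
          (2 / (2 + (d : ℝ) / (p : ℝ))) := by
  refine ⟨528, by norm_num, ?_⟩
  intro d p hp μ ν iμ iν hμ hν hm
  have hae : ∀ ρ : Measure (EuclideanSpace ℝ (Fin d)), IsProbabilityMeasure ρ →
      ρ (Metric.closedBall (0 : EuclideanSpace ℝ (Fin d)) 1) = 1 → ∀ᵐ x ∂ρ, ‖x‖ ≤ 1 := by
    intro ρ _ h
    have := (prob_compl_eq_zero_iff (μ := ρ) Metric.isClosed_closedBall.measurableSet).2 h
    have h2 : ∀ᵐ x ∂ρ, x ∈ Metric.closedBall (0 : EuclideanSpace ℝ (Fin d)) 1 := this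
    filter_upwards [h2] with x hx
    simpa using hx
  have hM := zolSup_nonneg p μ ν
  change _ ≤ (528 * (d : ℝ)) ^ p * (zolSup p μ ν) ^ (2 / (2 + (d : ℝ) / (p : ℝ)))
  refine Real.sSup_le ?_ (by positivity)
  rintro z ⟨u, hu, hmd, rfl⟩
  exact opt_bound hp hM fun σ hσ => main_bound hp (hae μ iμ hμ) (hae ν iν hν) hm hσ hu hmd
end
end

section
/- Let q > 1 and b ≥ 0, and let μ and ν be Borel probability measures on ℝ^d with ∫|x|^q dμ(x) ≤ b^q and ∫|x|^q dν(x) ≤ b^q. Then there is an absolute constant c > 0 such that W(μ,ν) ≤ c · b^{1−β} · (sup_{|θ|=1} W(μ_θ, ν_θ))^β, where β = 2 / (2 + d q/(q−1)). -/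
open MeasureTheory
open scoped RealInnerProductSpace ENNReal NNReal

noncomputable section


/-- The Kantorovich (Wasserstein-1) transport distance `W(μ,ν)`:
the infimum of `∬ ‖x - y‖ dπ(x,y)` over all couplings `π` of `μ` and `ν`. -/
def kantorovichW {X : Type*} [NormedAddCommGroup X] [MeasurableSpace X]
    (μ ν : Measure X) : ℝ :=
  (⨅ π ∈ {π : Measure (X × X) | π.map Prod.fst = μ ∧ π.map Prod.snd = ν},
    ∫⁻ z, (‖z.1 - z.2‖₊ : ℝ≥0∞) ∂π).toReal


theorem finite_duality {E ι : Type*} [NormedAddCommGroup E] [Fintype ι] [Nonempty ι]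
    (x : ι → E) (p q : ι → ℝ) (hp : ∀ i, 0 ≤ p i) (hq : ∀ i, 0 ≤ q i)
    (hp1 : ∑ i, p i = 1) (hq1 : ∑ i, q i = 1) (K : ℝ)
    (h : ∀ f : E → ℝ, LipschitzWith 1 f → ∑ i, f (x i) * (p i - q i) ≤ K) :
    ∃ w : ι × ι → ℝ, (∀ z, 0 ≤ w z) ∧ (∀ i, ∑ j, w (i, j) = p i) ∧ (∀ j, ∑ i, w (i, j) = q j) ∧
      ∑ z, w z * ‖x z.1 - x z.2‖ ≤ K := by
  classical
  let L : (ι × ι → ℝ) →ₗ[ℝ] ((ι → ℝ) × (ι → ℝ) × ℝ) :=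
    { toFun := fun w => (fun i => ∑ j, w (i, j), fun j => ∑ i, w (i, j),
        ∑ z, w z * ‖x z.1 - x z.2‖)
      map_add' := by
        intro a b
        simp only [Pi.add_apply, add_mul, Finset.sum_add_distrib]
        rfl
      map_smul' := by
        intro a b
        simp only [Pi.smul_apply, smul_eq_mul, mul_assoc, ← Finset.mul_sum]
        rfl }
  have hLc : Continuous L := LinearMap.continuous_of_finiteDimensional L
  by_contra hcon
  push Not at hcon
  have hdisj : Disjoint (L '' stdSimplex ℝ (ι × ι))
      (({p} : Set (ι → ℝ)) ×ˢ (({q} : Set (ι → ℝ)) ×ˢ Set.Iic K)) := by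
    rw [Set.disjoint_left]
    rintro _ ⟨w, hw, rfl⟩ hmem
    simp only [Set.mem_prod, Set.mem_singleton_iff, Set.mem_Iic] at hmem
    obtain ⟨h1, h2, h3⟩ := hmem
    exact absurd h3 (not_le.2 (hcon w hw.1 (fun i => congrFun h1 i) (fun j => congrFun h2 j)))
  obtain ⟨φ, u, v, hu, huv, hv⟩ := geometric_hahn_banach_compact_closed
    ((convex_stdSimplex ℝ (ι × ι)).linear_image L) ((isCompact_stdSimplex ℝ (ι × ι)).image hLc)
    ((convex_singleton p).prod ((convex_singleton q).prod (convex_Iic K)))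
    (isClosed_singleton.prod (isClosed_singleton.prod isClosed_Iic)) hdisj
  set a : ι → ℝ := fun i => φ (Pi.single i 1, 0, 0) with ha
  set b : ι → ℝ := fun j => φ (0, Pi.single j 1, 0) with hb
  set l : ℝ := φ (0, 0, 1) with hl
  have hφ : ∀ y z c, φ (y, z, c) = ∑ i, y i * a i + ∑ j, z j * b j + c * l := by
    intro y z c
    have e : (y, z, c) = ((y, 0, 0) : (ι → ℝ) × (ι → ℝ) × ℝ) + (0, z, 0) + (0, 0, c) := by simp
    rw [e, map_add, map_add]
    have e1 := LinearMap.pi_apply_eq_sum_univ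
      ((φ : ((ι → ℝ) × (ι → ℝ) × ℝ) →ₗ[ℝ] ℝ) ∘ₗ LinearMap.inl ℝ (ι → ℝ) ((ι → ℝ) × ℝ)) y
    have e2 := LinearMap.pi_apply_eq_sum_univ
      ((φ : ((ι → ℝ) × (ι → ℝ) × ℝ) →ₗ[ℝ] ℝ) ∘ₗ LinearMap.inr ℝ (ι → ℝ) ((ι → ℝ) × ℝ)
        ∘ₗ LinearMap.inl ℝ (ι → ℝ) ℝ) z
    have e3 : φ (0, 0, c) = c * l := by
      have : ((0, 0, c) : (ι → ℝ) × (ι → ℝ) × ℝ) = c • (0, 0, 1) := by simp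
      rw [this, map_smul, smul_eq_mul]
    simp only [LinearMap.comp_apply, LinearMap.inl_apply, LinearMap.inr_apply,
      ContinuousLinearMap.coe_coe, smul_eq_mul] at e1 e2
    have s : ∀ i : ι, (fun j => if i = j then (1:ℝ) else 0) = Pi.single i 1 := by
      intro i; ext j; simp [Pi.single_apply, eq_comm]
    simp only [s] at e1 e2
    rw [e3]
    congr 1
    congr 1
  have hcol : ∀ i j, a i + b j + ‖x i - x j‖ * l < u := by
    intro i j
    have := hu (L (Pi.single (i, j) 1)) ⟨_, single_mem_stdSimplex ℝ (i, j), rfl⟩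
    have e : L (Pi.single (i, j) 1) = (Pi.single i 1, Pi.single j 1, ‖x i - x j‖) := by
      refine Prod.ext ?_ (Prod.ext ?_ ?_)
      · ext i'
        simp only [L, LinearMap.coe_mk, AddHom.coe_mk, Pi.single_apply, Prod.mk.injEq]
        by_cases hh : i' = i <;> simp [hh]
      · ext i'
        simp only [L, LinearMap.coe_mk, AddHom.coe_mk, Pi.single_apply, Prod.mk.injEq]
        by_cases hh : i' = j <;> simp [hh]
      · simp [L, Pi.single_apply]
    rw [e, hφ] at this
    simpa [Pi.single_apply] using this
  have hS : ∀ c ≤ K, v < ∑ i, p i * a i + ∑ j, q j * b j + c * l := by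
    intro c hc
    rw [← hφ]
    exact hv _ (by simp [hc])
  have hl0 : l ≤ 0 := by
    by_contra hl0
    push Not at hl0
    set M := ∑ i, p i * a i + ∑ j, q j * b j
    have := hS (min K ((v - M) / l)) (min_le_left _ _)
    have h2 : min K ((v - M) / l) * l ≤ (v - M) / l * l :=
      mul_le_mul_of_nonneg_right (min_le_right _ _) hl0.le
    rw [div_mul_cancel₀ _ hl0.ne'] at h2
    linarith
  -- c-transform
  have havg : ∀ (g k : ι → ℝ), ∑ i, p i * g i + ∑ j, q j * k j
      = ∑ i, ∑ j, p i * q j * (g i + k j) := by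
    intro g k
    simp only [mul_add, Finset.sum_add_distrib]
    congr 1
    · refine Finset.sum_congr rfl fun i _ => ?_
      rw [← Finset.sum_mul, ← Finset.mul_sum, hq1, mul_one]
    · rw [Finset.sum_comm]
      refine Finset.sum_congr rfl fun j _ => ?_
      rw [← Finset.sum_mul, ← Finset.sum_mul, hp1, one_mul]
  rcases hl0.lt_or_eq with hneg | h0
  · let f : E → ℝ := fun y => Finset.univ.inf' Finset.univ_nonempty
      (fun j => ‖y - x j‖ + (u - b j) / (-l))
    have hf : LipschitzWith 1 f := by
      refine LipschitzWith.of_le_add fun y z => ?_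
      obtain ⟨j, -, hj⟩ := Finset.exists_mem_eq_inf' Finset.univ_nonempty
        (fun j => ‖z - x j‖ + (u - b j) / (-l))
      have h1 : f y ≤ ‖y - x j‖ + (u - b j) / (-l) := Finset.inf'_le _ (Finset.mem_univ j)
      have h2 : ‖y - x j‖ ≤ ‖y - z‖ + ‖z - x j‖ := norm_sub_le_norm_sub_add_norm_sub _ _ _
      have h3 : f z = ‖z - x j‖ + (u - b j) / (-l) := hj
      rw [dist_eq_norm]; linarith
    have hfa : ∀ i, a i / (-l) ≤ f (x i) := by
      intro i
      refine Finset.le_inf' _ _ fun j _ => ?_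
      have := hcol i j
      rw [div_le_iff₀ (by linarith), add_mul, div_mul_cancel₀ _ (by linarith)]
      linarith
    have hfb : ∀ j, f (x j) ≤ (u - b j) / (-l) := by
      intro j
      have h1 : f (x j) ≤ ‖x j - x j‖ + (u - b j) / (-l) := Finset.inf'_le _ (Finset.mem_univ j)
      simpa using h1
    have h1 := h f hf
    have h2 := hS K le_rfl
    have h3 : ∑ i, p i * (a i / (-l)) ≤ ∑ i, p i * f (x i) :=
      Finset.sum_le_sum fun i _ => mul_le_mul_of_nonneg_left (hfa i) (hp i)
    have h4 : ∑ i, q i * f (x i) ≤ ∑ i, q i * ((u - b i) / (-l)) :=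
      Finset.sum_le_sum fun i _ => mul_le_mul_of_nonneg_left (hfb i) (hq i)
    have h5 : ∑ i, f (x i) * (p i - q i) = ∑ i, p i * f (x i) - ∑ i, q i * f (x i) := by
      rw [← Finset.sum_sub_distrib]
      exact Finset.sum_congr rfl fun i _ => by ring
    have h6 : ∑ i, p i * (a i / (-l)) = (∑ i, p i * a i) / (-l) := by
      rw [Finset.sum_div]; exact Finset.sum_congr rfl fun i _ => by ring
    have h7 : ∑ i, q i * ((u - b i) / (-l)) = (u - ∑ i, q i * b i) / (-l) := by
      have e : u = ∑ i, q i * u := by rw [← Finset.sum_mul, hq1, one_mul]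
      conv_rhs => rw [e, ← Finset.sum_sub_distrib, Finset.sum_div]
      exact Finset.sum_congr rfl fun i _ => by ring
    have h8 : (∑ i, p i * a i) / (-l) - (u - ∑ i, q i * b i) / (-l) ≤ K := by linarith
    rw [← sub_div, div_le_iff₀ (by linarith)] at h8
    linarith
  · have h2 := hS K le_rfl
    rw [h0, mul_zero, add_zero, havg] at h2
    have : ∑ i, ∑ j, p i * q j * (a i + b j) ≤ ∑ i, ∑ j, p i * q j * u := by
      refine Finset.sum_le_sum fun i _ => Finset.sum_le_sum fun j _ =>
        mul_le_mul_of_nonneg_left ?_ (mul_nonneg (hp i) (hq j))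
      have := hcol i j
      rw [h0] at this
      linarith
    have e : ∑ i, ∑ j, p i * q j * u = u := by
      simp only [← Finset.sum_mul, ← Finset.mul_sum, hq1, hp1, mul_one, one_mul]
    linarith
theorem duality_aux {E : Type*} [NormedAddCommGroup E] [MeasurableSpace E] [BorelSpace E]
    [SecondCountableTopology E] (μ ν : Measure E) [IsProbabilityMeasure μ] [IsProbabilityMeasure ν]
    (hμ : Integrable (fun x : E => x) μ) (hν : Integrable (fun x : E => x) ν) (K : ℝ)
    (h : ∀ f : E → ℝ, LipschitzWith 1 f → ∫ x, f x ∂μ - ∫ x, f x ∂ν ≤ K)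
    (T : SimpleFunc E E) (ε : ℝ) (hε : 0 ≤ ε)
    (h1 : ∫⁻ x, ‖T x - x‖ₑ ∂μ ≤ ENNReal.ofReal ε) (h2 : ∫⁻ x, ‖T x - x‖ₑ ∂ν ≤ ENNReal.ofReal ε) :
    ∃ π : Measure (E × E), (π.map Prod.fst = μ ∧ π.map Prod.snd = ν) ∧
      ∫⁻ z, (‖z.1 - z.2‖₊ : ℝ≥0∞) ∂π ≤ ENNReal.ofReal (K + 4 * ε) := by
  classical
  have hne : Nonempty E := ⟨0⟩
  let A : T.range → Set E := fun i => T ⁻¹' {(i : E)}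
  have hA : ∀ i, MeasurableSet (A i) := fun i => T.measurableSet_fiber _
  have hAd : Pairwise (Function.onFun Disjoint A) := by
    intro i j hij
    refine Set.disjoint_left.2 fun x hx hy => hij (Subtype.ext ?_)
    simp only [A, Set.mem_preimage, Set.mem_singleton_iff] at hx hy
    rw [← hx, ← hy]
  have hAu : ⋃ i, A i = Set.univ := by
    refine Set.eq_univ_of_forall fun x => Set.mem_iUnion.2 ⟨⟨T x, T.mem_range_self x⟩, by simp [A]⟩
  have hne' : Nonempty T.range := ⟨⟨T 0, T.mem_range_self 0⟩⟩
  have hsum : ∀ (ρ : Measure E), ∑ i, ρ.restrict (A i) = ρ := by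
    intro ρ
    rw [← Measure.sum_fintype, ← Measure.restrict_iUnion hAd hA, hAu, Measure.restrict_univ]
  have hsum1 : ∀ (ρ : Measure E) [IsProbabilityMeasure ρ], ∑ i, ρ.real (A i) = 1 := by
    intro ρ _
    have := congrArg (fun m : Measure E => m Set.univ) (hsum ρ)
    simp only [Measure.finsetSum_apply, Measure.restrict_apply_univ, measure_univ] at this
    simp only [Measure.real]
    rw [← ENNReal.toReal_sum (fun i _ => measure_ne_top _ _), this]; rfl
  have hTint : ∀ (ρ : Measure E) [IsProbabilityMeasure ρ], Integrable (fun x : E => x) ρ →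
      ∫⁻ x, ‖T x - x‖ₑ ∂ρ ≤ ENNReal.ofReal ε → ∀ f : E → ℝ, LipschitzWith 1 f →
      |∑ i : T.range, f i * ρ.real (A i) - ∫ x, f x ∂ρ| ≤ ε := by
    intro ρ _ hρ hle f hf
    have hfi : Integrable f ρ := by
      refine Integrable.mono' (hρ.norm.add (integrable_const |f 0|)) 
        hf.continuous.aestronglyMeasurable (ae_of_all _ fun x => ?_)
      have := hf.dist_le_mul x 0
      simp only [dist_zero_right, NNReal.coe_one, one_mul, Real.dist_eq] at this
      rw [Real.norm_eq_abs]
      have h3 := abs_sub_abs_le_abs_sub (f x) (f 0)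
      simp only [Pi.add_apply]
      linarith
    have hTi : Integrable (fun x => f (T x)) ρ := (T.map f).integrable_of_isFiniteMeasure
    have e : ∑ i : T.range, f i * ρ.real (A i) = ∫ x, f (T x) ∂ρ := by
      have := SimpleFunc.map_integral (E := E) (F := ℝ) (μ := ρ) T f
      have e1 : ∫ x, f (T x) ∂ρ = ∑ i : T.range, ∫ x in A i, f (T x) ∂ρ := by
        rw [← setIntegral_univ, ← hAu, integral_iUnion_fintype hA hAd]
        intro i; exact hTi.integrableOn
      rw [e1]
      refine Finset.sum_congr rfl fun i _ => ?_
      rw [setIntegral_congr_fun (g := fun _ => f i) (hA i), setIntegral_const, smul_eq_mul, mul_comm]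
      intro x hx
      simp only [A, Set.mem_preimage, Set.mem_singleton_iff] at hx
      simp only [hx]
    rw [e, ← integral_sub hTi hfi, ← Real.norm_eq_abs]
    refine (norm_integral_le_lintegral_norm _).trans ?_
    refine ENNReal.toReal_le_of_le_ofReal hε (le_trans (lintegral_mono fun x => ?_) hle)
    rw [ofReal_norm, ← edist_eq_enorm_sub, ← edist_eq_enorm_sub]
    simpa using hf (T x) x
  obtain ⟨w, hw0, hw1, hw2, hw3⟩ := finite_duality (fun i : T.range => (i : E))
    (fun i => μ.real (A i)) (fun i => ν.real (A i)) (fun _ => measureReal_nonneg)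
    (fun _ => measureReal_nonneg) (hsum1 μ) (hsum1 ν) (K + 2 * ε) (by
      intro f hf
      have e1 := abs_le.1 (hTint μ hμ h1 f hf)
      have e2 := abs_le.1 (hTint ν hν h2 f hf)
      have e3 := h f hf
      simp only [mul_sub, Finset.sum_sub_distrib]
      linarith)
  have hz1 : ∀ i j, μ (A i) = 0 → w (i, j) = 0 := by
    intro i j h0
    have := hw1 i
    simp only [Measure.real, h0, ENNReal.toReal_zero] at this
    exact (Finset.sum_eq_zero_iff_of_nonneg (fun _ _ => hw0 _)).1 this j (Finset.mem_univ _)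
  have hz2 : ∀ i j, ν (A j) = 0 → w (i, j) = 0 := by
    intro i j h0
    have := hw2 j
    simp only [Measure.real, h0, ENNReal.toReal_zero] at this
    exact (Finset.sum_eq_zero_iff_of_nonneg (fun _ _ => hw0 _)).1 this i (Finset.mem_univ _)
  let c : T.range → T.range → ℝ≥0∞ := fun i j =>
    ENNReal.ofReal (w (i, j)) / μ (A i) / ν (A j)
  have hc1 : ∀ i j, c i j * ν (A j) = ENNReal.ofReal (w (i, j)) / μ (A i) := by
    intro i j
    by_cases h0 : ν (A j) = 0
    · simp [h0, hz2 i j h0]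
    · exact ENNReal.div_mul_cancel h0 (measure_ne_top _ _)
  have hc2 : ∀ i j, c i j * ν (A j) * μ (A i) = ENNReal.ofReal (w (i, j)) := by
    intro i j
    rw [hc1]
    by_cases h0 : μ (A i) = 0
    · simp [h0, hz1 i j h0]
    · exact ENNReal.div_mul_cancel h0 (measure_ne_top _ _)
  have hc3 : ∀ i j, c i j * μ (A i) = ENNReal.ofReal (w (i, j)) / ν (A j) := by
    intro i j
    by_cases h0 : ν (A j) = 0
    · simp [c, h0, hz2 i j h0]
    · rw [← hc2 i j, mul_right_comm]
      exact (ENNReal.mul_div_cancel_right h0 (measure_ne_top _ _)).symm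
  let π : Measure (E × E) := ∑ i, ∑ j, c i j • ((μ.restrict (A i)).prod (ν.restrict (A j)))
  have hπ1 : π.map Prod.fst = μ := by
    have : π.map Prod.fst = ∑ i, ∑ j, (c i j * ν (A j)) • μ.restrict (A i) := by
      simp only [π]
      rw [← Measure.mapₗ_apply_of_measurable measurable_fst]
      simp only [map_sum]
      refine Finset.sum_congr rfl fun i _ => Finset.sum_congr rfl fun j _ => ?_
      rw [Measure.mapₗ_apply_of_measurable measurable_fst, Measure.map_smul, Measure.map_fst_prod,
        Measure.restrict_apply_univ, smul_smul]
    rw [this]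
    conv_rhs => rw [← hsum μ]
    refine Finset.sum_congr rfl fun i _ => ?_
    rw [← Finset.sum_smul]
    by_cases h0 : μ (A i) = 0
    · rw [Measure.restrict_eq_zero.2 h0, smul_zero]
    · have : ∑ j, c i j * ν (A j) = 1 := by
        simp only [hc1, div_eq_mul_inv]
        rw [← Finset.sum_mul, ← ENNReal.ofReal_sum_of_nonneg (fun _ _ => hw0 _), hw1,
          ofReal_measureReal]
        exact ENNReal.mul_inv_cancel h0 (measure_ne_top _ _)
      rw [this, one_smul]
  have hπ2 : π.map Prod.snd = ν := by
    have : π.map Prod.snd = ∑ j, ∑ i, (c i j * μ (A i)) • ν.restrict (A j) := by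
      simp only [π]
      rw [Finset.sum_comm, ← Measure.mapₗ_apply_of_measurable measurable_snd]
      simp only [map_sum]
      refine Finset.sum_congr rfl fun i _ => Finset.sum_congr rfl fun j _ => ?_
      rw [Measure.mapₗ_apply_of_measurable measurable_snd, Measure.map_smul, Measure.map_snd_prod,
        Measure.restrict_apply_univ, smul_smul]
    rw [this]
    conv_rhs => rw [← hsum ν]
    refine Finset.sum_congr rfl fun j _ => ?_
    rw [← Finset.sum_smul]
    by_cases h0 : ν (A j) = 0
    · rw [Measure.restrict_eq_zero.2 h0, smul_zero]
    · have : ∑ i, c i j * μ (A i) = 1 := by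
        simp only [hc3, div_eq_mul_inv]
        rw [← Finset.sum_mul, ← ENNReal.ofReal_sum_of_nonneg (fun _ _ => hw0 _), hw2,
          ofReal_measureReal]
        exact ENNReal.mul_inv_cancel h0 (measure_ne_top _ _)
      rw [this, one_smul]
  refine ⟨π, ⟨hπ1, hπ2⟩, ?_⟩
  have hm : Measurable (fun x : E => ‖T x - x‖ₑ) := (T.measurable.sub measurable_id).enorm
  have b1 : ∫⁻ z, ‖T z.1 - z.1‖ₑ ∂π ≤ ENNReal.ofReal ε := by
    rw [← lintegral_map (f := fun x => ‖T x - x‖ₑ) hm measurable_fst, hπ1]; exact h1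
  have b2 : ∫⁻ z, ‖T z.2 - z.2‖ₑ ∂π ≤ ENNReal.ofReal ε := by
    rw [← lintegral_map (f := fun x => ‖T x - x‖ₑ) hm measurable_snd, hπ2]; exact h2
  have b3 : ∫⁻ z, ‖T z.1 - T z.2‖ₑ ∂π ≤ ENNReal.ofReal (K + 2 * ε) := by
    refine le_trans (le_of_eq ?_) (ENNReal.ofReal_le_ofReal hw3)
    rw [ENNReal.ofReal_sum_of_nonneg (fun z _ => mul_nonneg (hw0 z) (norm_nonneg _)),
      Fintype.sum_prod_type]
    simp only [π, lintegral_finsetSum_measure, lintegral_smul_measure]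
    refine Finset.sum_congr rfl fun i _ => Finset.sum_congr rfl fun j _ => ?_
    rw [Measure.prod_restrict, setLIntegral_congr_fun (g := fun _ => ‖(i : E) - j‖ₑ)
      ((hA i).prod (hA j)), setLIntegral_const, Measure.prod_prod, ENNReal.ofReal_mul (hw0 _),
      ← hc2, ofReal_norm, smul_eq_mul]
    · ring
    · rintro ⟨x, y⟩ ⟨hx, hy⟩
      simp only [A, Set.mem_preimage, Set.mem_singleton_iff] at hx hy
      simp only [hx, hy]
  calc ∫⁻ z, (‖z.1 - z.2‖₊ : ℝ≥0∞) ∂π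
      ≤ ∫⁻ z, (‖T z.1 - z.1‖ₑ + ‖T z.1 - T z.2‖ₑ) + ‖T z.2 - z.2‖ₑ ∂π := by
        refine lintegral_mono fun z => ?_
        change ‖z.1 - z.2‖ₑ ≤ _
        have e : z.1 - z.2 = (-(T z.1 - z.1) + (T z.1 - T z.2)) + (T z.2 - z.2) := by abel
        rw [e]
        refine (enorm_add_le _ _).trans (add_le_add_left ((enorm_add_le _ _).trans ?_) _)
        rw [enorm_neg]
    _ = ∫⁻ z, ‖T z.1 - z.1‖ₑ ∂π + ∫⁻ z, ‖T z.1 - T z.2‖ₑ ∂π + ∫⁻ z, ‖T z.2 - z.2‖ₑ ∂π := by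
        have m1 : Measurable (fun z : E × E => ‖T z.1 - z.1‖ₑ) := hm.comp measurable_fst
        have m2 : Measurable (fun z : E × E => ‖T z.2 - z.2‖ₑ) := hm.comp measurable_snd
        rw [lintegral_add_right _ m2, lintegral_add_left m1]
    _ ≤ ENNReal.ofReal ε + ENNReal.ofReal (K + 2 * ε) + ENNReal.ofReal ε := by gcongr
    _ = ENNReal.ofReal (K + 4 * ε) := by
        have hK : 0 ≤ K := by simpa using h (fun _ => 0) (LipschitzWith.const' 0)
        rw [← ENNReal.ofReal_add hε (by positivity), ← ENNReal.ofReal_add (by positivity) hε]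
        congr 1; ring

theorem kantorovich_duality {E : Type*} [NormedAddCommGroup E] [MeasurableSpace E] [BorelSpace E]
    [SecondCountableTopology E] (μ ν : Measure E) [IsProbabilityMeasure μ] [IsProbabilityMeasure ν]
    (hμ : Integrable (fun x : E => x) μ) (hν : Integrable (fun x : E => x) ν) (K : ℝ)
    (h : ∀ f : E → ℝ, LipschitzWith 1 f → ∫ x, f x ∂μ - ∫ x, f x ∂ν ≤ K) :
    kantorovichW μ ν ≤ K := by
  have hK : 0 ≤ K := by simpa using h (fun _ => 0) (LipschitzWith.const' 0)
  refine le_of_forall_pos_le_add fun δ hδ => ?_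
  have hε : (0 : ℝ≥0∞) < ENNReal.ofReal (δ / 4) := ENNReal.ofReal_pos.2 (by positivity)
  have t : ∀ ρ : Measure E, Integrable (fun x : E => x) ρ → Filter.Tendsto (fun n =>
      ∫⁻ x, ‖SimpleFunc.approxOn (fun x : E => x) measurable_id Set.univ 0 (Set.mem_univ _) n x - x‖ₑ ∂ρ)
      Filter.atTop (nhds 0) := by
    intro ρ hρ
    refine SimpleFunc.tendsto_approxOn_L1_enorm measurable_id (Set.mem_univ _) (by simp) ?_
    simpa using hρ.2
  obtain ⟨n, hn1, hn2⟩ := ((t μ hμ).eventually_lt_const hε |>.and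
    ((t ν hν).eventually_lt_const hε)).exists
  obtain ⟨π, hπ, hle⟩ := duality_aux μ ν hμ hν K h _ (δ / 4) (by positivity) hn1.le hn2.le
  unfold kantorovichW
  refine ENNReal.toReal_le_of_le_ofReal (by positivity) ?_
  refine (iInf₂_le π hπ).trans (hle.trans (le_of_eq ?_))
  congr 1; ring
theorem kantorovichW_nonneg {X : Type*} [NormedAddCommGroup X] [MeasurableSpace X]
    (μ ν : Measure X) : 0 ≤ kantorovichW μ ν := ENNReal.toReal_nonneg

theorem lintegral_nnnorm_le {E : Type*} [NormedAddCommGroup E] [MeasurableSpace E] [BorelSpace E]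
    [SecondCountableTopology E] (μ : Measure E) [IsProbabilityMeasure μ] (q b : ℝ) (hq : 1 < q)
    (hb : 0 ≤ b) (h : ∫⁻ x, (‖x‖₊ : ℝ≥0∞) ^ q ∂μ ≤ ENNReal.ofReal (b ^ q)) :
    ∫⁻ x, (‖x‖₊ : ℝ≥0∞) ∂μ ≤ ENNReal.ofReal b := by
  have hm : AEStronglyMeasurable (fun x : E => x) μ := aestronglyMeasurable_id
  have h1 := eLpNorm'_le_eLpNorm'_of_exponent_le (f := fun x : E => x) (p := 1) (q := q)
    zero_lt_one hq.le μ hm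
  simp only [eLpNorm'_eq_lintegral_enorm, ENNReal.rpow_one, div_one] at h1
  refine h1.trans ?_
  calc (∫⁻ x, ‖x‖ₑ ^ q ∂μ) ^ (1 / q) ≤ (ENNReal.ofReal (b ^ q)) ^ (1 / q) :=
        ENNReal.rpow_le_rpow h (by positivity)
    _ = ENNReal.ofReal b := by
        rw [ENNReal.ofReal_rpow_of_nonneg (by positivity) (by positivity), ← Real.rpow_mul hb,
          mul_one_div_cancel (by positivity), Real.rpow_one]

theorem infCost_le {E : Type*} [NormedAddCommGroup E] [MeasurableSpace E] [BorelSpace E]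
    [SecondCountableTopology E] (μ ν : Measure E) [IsProbabilityMeasure μ] [IsProbabilityMeasure ν]
    (b : ℝ) (hb : 0 ≤ b) (h1 : ∫⁻ x, (‖x‖₊ : ℝ≥0∞) ∂μ ≤ ENNReal.ofReal b)
    (h2 : ∫⁻ x, (‖x‖₊ : ℝ≥0∞) ∂ν ≤ ENNReal.ofReal b) :
    (⨅ π ∈ {π : Measure (E × E) | π.map Prod.fst = μ ∧ π.map Prod.snd = ν},
    ∫⁻ z, (‖z.1 - z.2‖₊ : ℝ≥0∞) ∂π) ≤ ENNReal.ofReal (2 * b) := by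
  refine (iInf₂_le (μ.prod ν) ⟨by simp [Measure.map_fst_prod], by simp [Measure.map_snd_prod]⟩).trans ?_
  calc ∫⁻ z, (‖z.1 - z.2‖₊ : ℝ≥0∞) ∂(μ.prod ν)
      ≤ ∫⁻ z : E × E, ‖z.1‖ₑ + ‖z.2‖ₑ ∂(μ.prod ν) := lintegral_mono fun z => enorm_sub_le
    _ = ∫⁻ z : E × E, ‖z.1‖ₑ ∂(μ.prod ν) + ∫⁻ z : E × E, ‖z.2‖ₑ ∂(μ.prod ν) :=
        lintegral_add_left measurable_fst.enorm _
    _ = ∫⁻ x, ‖x‖ₑ ∂((μ.prod ν).map Prod.fst) + ∫⁻ x, ‖x‖ₑ ∂((μ.prod ν).map Prod.snd) := by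
        rw [lintegral_map measurable_enorm measurable_fst,
          lintegral_map measurable_enorm measurable_snd]
    _ ≤ ENNReal.ofReal b + ENNReal.ofReal b := by
        simp only [Measure.map_fst_prod, Measure.map_snd_prod, measure_univ, one_smul]
        exact add_le_add h1 h2
    _ = ENNReal.ofReal (2 * b) := by rw [← ENNReal.ofReal_add hb hb, two_mul]

theorem kantorovichW_le {E : Type*} [NormedAddCommGroup E] [MeasurableSpace E] [BorelSpace E]
    [SecondCountableTopology E] (μ ν : Measure E) [IsProbabilityMeasure μ] [IsProbabilityMeasure ν]
    (b : ℝ) (hb : 0 ≤ b) (h1 : ∫⁻ x, (‖x‖₊ : ℝ≥0∞) ∂μ ≤ ENNReal.ofReal b)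
    (h2 : ∫⁻ x, (‖x‖₊ : ℝ≥0∞) ∂ν ≤ ENNReal.ofReal b) : kantorovichW μ ν ≤ 2 * b :=
  ENNReal.toReal_le_of_le_ofReal (by positivity) (infCost_le μ ν b hb h1 h2)

theorem lintegral_proj_le {E : Type*} [NormedAddCommGroup E] [InnerProductSpace ℝ E]
    [MeasurableSpace E] [BorelSpace E]
    [SecondCountableTopology E] (μ : Measure E) (θ : E) (hθ : ‖θ‖ = 1) :
    ∫⁻ x, (‖x‖₊ : ℝ≥0∞) ∂(μ.map (fun x => ⟪x, θ⟫)) ≤ ∫⁻ x, (‖x‖₊ : ℝ≥0∞) ∂μ := by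
  rw [lintegral_map (by fun_prop) (by fun_prop)]
  refine lintegral_mono fun x => ?_
  have := norm_inner_le_norm (𝕜 := ℝ) x θ
  rw [hθ, mul_one] at this
  exact ENNReal.coe_le_coe.2 this

/-- difference of characteristic functions on the line -/
theorem norm_charFun_sub_le (μ ν : Measure ℝ) [IsProbabilityMeasure μ] [IsProbabilityMeasure ν]
    (hfin : (⨅ π ∈ {π : Measure (ℝ × ℝ) | π.map Prod.fst = μ ∧ π.map Prod.snd = ν},
    ∫⁻ z, (‖z.1 - z.2‖₊ : ℝ≥0∞) ∂π) ≠ ∞) (a : ℝ) :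
    ‖∫ x, Complex.exp ((a * x : ℝ) * Complex.I) ∂μ - ∫ x, Complex.exp ((a * x : ℝ) * Complex.I) ∂ν‖
      ≤ |a| * kantorovichW μ ν := by
  refine le_of_forall_pos_le_add fun δ hδ => ?_
  set I := (⨅ π ∈ {π : Measure (ℝ × ℝ) | π.map Prod.fst = μ ∧ π.map Prod.snd = ν},
    ∫⁻ z, (‖z.1 - z.2‖₊ : ℝ≥0∞) ∂π) with hI
  set η : ℝ := δ / (|a| + 1) with hη
  have hη0 : 0 < η := by positivity
  have hlt : I < I + ENNReal.ofReal η :=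
    ENNReal.lt_add_right hfin (ENNReal.ofReal_pos.2 hη0).ne'
  rw [hI] at hlt
  simp only [iInf_lt_iff] at hlt
  obtain ⟨π, ⟨hπ1, hπ2⟩, hπ⟩ := hlt
  rw [← hI] at hπ
  have : IsProbabilityMeasure π := by
    constructor
    have := congrArg (fun m : Measure ℝ => m Set.univ) hπ1
    simpa [Measure.map_apply measurable_fst MeasurableSet.univ] using this
  have hfinπ : ∫⁻ z, (‖z.1 - z.2‖₊ : ℝ≥0∞) ∂π ≠ ∞ :=
    (hπ.trans (ENNReal.add_lt_top.2 ⟨hfin.lt_top, ENNReal.ofReal_lt_top⟩)).ne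
  have hi : ∀ g : ℝ × ℝ → ℝ, Continuous g → 
      Integrable (fun z => Complex.exp ((g z : ℝ) * Complex.I)) π := by
    intro g hg
    refine Integrable.mono' (integrable_const (1 : ℝ)) (by fun_prop) (ae_of_all _ fun z => ?_)
    rw [Complex.norm_exp_ofReal_mul_I]
  have hsub : Integrable (fun z : ℝ × ℝ => z.1 - z.2) π :=
    ⟨by fun_prop, hfinπ.lt_top⟩
  conv_lhs => rw [← hπ1, ← hπ2]
  rw [integral_map (by fun_prop) (by fun_prop), integral_map (by fun_prop) (by fun_prop),
    ← integral_sub (hi (fun z => a * z.1) (by fun_prop)) (hi (fun z => a * z.2) (by fun_prop))]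
  calc _ ≤ ∫ z, ‖Complex.exp ((a * z.1 : ℝ) * Complex.I) - Complex.exp ((a * z.2 : ℝ) * Complex.I)‖ ∂π :=
        norm_integral_le_integral_norm _
    _ ≤ ∫ z, |a| * ‖z.1 - z.2‖ ∂π := by
        refine integral_mono_of_nonneg (ae_of_all _ fun _ => norm_nonneg _) (hsub.norm.const_mul _)
          (ae_of_all _ fun z => ?_)
        have e : Complex.exp ((a * z.1 : ℝ) * Complex.I) - Complex.exp ((a * z.2 : ℝ) * Complex.I)
          = Complex.exp ((a * z.2 : ℝ) * Complex.I) *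
            (Complex.exp (Complex.I * (a * (z.1 - z.2) : ℝ)) - 1) := by
          rw [mul_sub, ← Complex.exp_add, mul_one]
          congr 2
          push_cast; ring
        simp only [e]
        rw [norm_mul, Complex.norm_exp_ofReal_mul_I, one_mul]
        refine (Real.norm_exp_I_mul_ofReal_sub_one_le).trans ?_
        rw [norm_mul, Real.norm_eq_abs a]
    _ = |a| * (∫⁻ z, (‖z.1 - z.2‖₊ : ℝ≥0∞) ∂π).toReal := by
        rw [integral_const_mul, integral_norm_eq_lintegral_enorm (by fun_prop)]; rfl
    _ ≤ |a| * (kantorovichW μ ν + η) := by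
        gcongr
        refine (ENNReal.toReal_mono ?_ hπ.le).trans ?_
        · exact ENNReal.add_ne_top.2 ⟨hfin, ENNReal.ofReal_ne_top⟩
        · rw [ENNReal.toReal_add hfin ENNReal.ofReal_ne_top, ENNReal.toReal_ofReal hη0.le]
          rfl
    _ ≤ |a| * kantorovichW μ ν + δ := by
        rw [mul_add]
        gcongr
        rw [hη, ← mul_div_assoc, div_le_iff₀ (by positivity)]
        nlinarith [abs_nonneg a]

open scoped FourierTransform SchwartzMap LineDeriv Convolution ContDiff

theorem schwartz_diff_le {d : ℕ} (μ ν : Measure (EuclideanSpace ℝ (Fin d)))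
    [IsProbabilityMeasure μ] [IsProbabilityMeasure ν] (s : ℝ)
    (hs : ∀ v : EuclideanSpace ℝ (Fin d),
      ‖∫ x, Complex.exp ((2 * Real.pi * ⟪v, x⟫ : ℝ) * Complex.I) ∂μ -
        ∫ x, Complex.exp ((2 * Real.pi * ⟪v, x⟫ : ℝ) * Complex.I) ∂ν‖ ≤ 2 * Real.pi * ‖v‖ * s)
    (H : 𝓢(EuclideanSpace ℝ (Fin d), ℂ)) :
    ‖∫ x, H x ∂μ - ∫ x, H x ∂ν‖ ≤ s * ∫ v, 2 * Real.pi * ‖v‖ * ‖𝓕 H v‖ := by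
  have hrep : ∀ x, H x = ∫ v, Complex.exp ((2 * Real.pi * ⟪v, x⟫ : ℝ) * Complex.I) • 𝓕 H v := by
    intro x
    have h1 : 𝓕⁻ (𝓕 H) x = H x := by simp
    rw [← h1, SchwartzMap.fourierInv_coe, Real.fourierInv_eq']
  have hpt : ∀ (ρ : Measure (EuclideanSpace ℝ (Fin d))) [IsProbabilityMeasure ρ],
      Integrable (Function.uncurry fun (x v : EuclideanSpace ℝ (Fin d)) =>
        Complex.exp ((2 * Real.pi * ⟪v, x⟫ : ℝ) * Complex.I) • 𝓕 H v) (ρ.prod volume) := by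
    intro ρ _
    refine Integrable.mono' (((𝓕 H).integrable (μ := volume)).norm.comp_snd ρ) ?_
      (ae_of_all _ fun z => ?_)
    · refine Continuous.aestronglyMeasurable ?_
      have := (𝓕 H).continuous
      simp only [Function.uncurry_def]
      fun_prop
    · simp only [Function.uncurry_def, norm_smul, Complex.norm_exp_ofReal_mul_I, one_mul]
      exact le_rfl
  have hsw : ∀ (ρ : Measure (EuclideanSpace ℝ (Fin d))) [IsProbabilityMeasure ρ],
      ∫ x, H x ∂ρ = ∫ v, (∫ x, Complex.exp ((2 * Real.pi * ⟪v, x⟫ : ℝ) * Complex.I) ∂ρ) * 𝓕 H v := by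
    intro ρ _
    simp_rw [hrep]
    rw [integral_integral_swap (hpt ρ)]
    refine integral_congr_ae (ae_of_all _ fun v => ?_)
    simp only [smul_eq_mul]
    rw [integral_mul_const]
  have hint : ∀ (ρ : Measure (EuclideanSpace ℝ (Fin d))) [IsProbabilityMeasure ρ],
      Integrable fun v => (∫ x, Complex.exp ((2 * Real.pi * ⟪v, x⟫ : ℝ) * Complex.I) ∂ρ) * 𝓕 H v := by
    intro ρ _
    have := (hpt ρ).integral_prod_right
    refine this.congr (ae_of_all _ fun v => ?_)
    simp only [Function.uncurry_def, smul_eq_mul]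
    rw [integral_mul_const]
  rw [hsw μ, hsw ν, ← integral_sub (hint μ) (hint ν), ← integral_const_mul]
  refine (norm_integral_le_integral_norm _).trans ?_
  refine integral_mono_of_nonneg (ae_of_all _ fun _ => norm_nonneg _) ?_ (ae_of_all _ fun v => ?_)
  · have := (((𝓕 H).integrable_pow_mul (μ := volume) 1).const_mul (s * (2 * Real.pi)))
    refine this.congr (ae_of_all _ fun v => ?_)
    simp only [pow_one]; ring
  · simp only
    rw [← sub_mul, norm_mul]
    calc _ ≤ (2 * Real.pi * ‖v‖ * s) * ‖𝓕 H v‖ := by gcongr; exact hs v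
      _ = _ := by ring

theorem fourier_cs {d : ℕ} (G Φ : 𝓢(EuclideanSpace ℝ (Fin d), ℂ)) (A B : ℝ)
    (hG : ∀ i : Fin d, ∫ x, ‖fderiv ℝ G x (EuclideanSpace.single i 1)‖ ^ 2 ≤ A)
    (hΦ : ∫ x, ‖Φ x‖ ^ 2 ≤ B) :
    ∫ v, 2 * Real.pi * ‖v‖ * ‖𝓕 Φ v * 𝓕 G v‖ ≤ d * (Real.sqrt A * Real.sqrt B) := by
  obtain ⟨D, hD⟩ : ∃ D : Fin d → 𝓢(EuclideanSpace ℝ (Fin d), ℂ),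
      ∀ i, D i = ∂_{EuclideanSpace.single i (1:ℝ)} G := ⟨_, fun _ => rfl⟩
  have hder : ∀ (i : Fin d) v, ‖𝓕 (D i) v‖
      = 2 * Real.pi * |v i| * ‖𝓕 G v‖ := by
    intro i v
    have : Function.HasTemperateGrowth
        (fun y : EuclideanSpace ℝ (Fin d) => inner ℝ y (EuclideanSpace.single i (1:ℝ))) :=
      ((innerSL ℝ).flip (EuclideanSpace.single i (1:ℝ))).hasTemperateGrowth
    rw [hD, SchwartzMap.fourier_lineDerivOp_eq]
    simp only [smul_apply, SchwartzMap.smulLeftCLM_apply_apply this, norm_smul, norm_mul]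
    simp [abs_of_pos Real.pi_pos, EuclideanSpace.inner_single_right]
    ring
  have hnorm : ∀ v : EuclideanSpace ℝ (Fin d), ‖v‖ ≤ ∑ i, |v i| := by
    intro v
    have : v = ∑ i, v i • EuclideanSpace.single i (1:ℝ) := by
      ext j; simp [Pi.single_apply]
    conv_lhs => rw [this]
    refine (norm_sum_le _ _).trans (Finset.sum_le_sum fun i _ => ?_)
    simp [norm_smul]
  have hint : ∀ i : Fin d, Integrable (fun v => ‖𝓕 (D i) v‖ * ‖𝓕 Φ v‖) := by
    intro i
    exact ((𝓕 (D i)).memLp 2).norm.integrable_mul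
      ((𝓕 Φ).memLp 2).norm
  calc ∫ v, 2 * Real.pi * ‖v‖ * ‖𝓕 Φ v * 𝓕 G v‖
      ≤ ∫ v, ∑ i, ‖𝓕 (D i) v‖ * ‖𝓕 Φ v‖ := by
        refine integral_mono_of_nonneg (ae_of_all _ fun _ => ?_)
          (integrable_finsetSum _ fun i _ => hint i) (ae_of_all _ fun v => ?_)
        · positivity
        · simp only [hder, norm_mul]
          rw [← Finset.sum_mul, ← Finset.sum_mul, ← Finset.mul_sum]
          calc _ ≤ 2 * Real.pi * (∑ i, |v i|) * (‖𝓕 Φ v‖ * ‖𝓕 G v‖) := by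
                gcongr; exact hnorm v
            _ = _ := by ring
    _ = ∑ i, ∫ v, ‖𝓕 (D i) v‖ * ‖𝓕 Φ v‖ :=
        integral_finsetSum _ fun i _ => hint i
    _ ≤ ∑ i : Fin d, Real.sqrt A * Real.sqrt B := by
        refine Finset.sum_le_sum fun i _ => ?_
        have := integral_mul_le_Lp_mul_Lq_of_nonneg (μ := volume) (p := 2) (q := 2)
          Real.HolderConjugate.two_two
          (f := fun v => ‖𝓕 (D i) v‖) (g := fun v => ‖𝓕 Φ v‖)
          (ae_of_all _ fun _ => norm_nonneg _) (ae_of_all _ fun _ => norm_nonneg _)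
          (by simpa using ((𝓕 (D i)).memLp 2).norm)
          (by simpa using ((𝓕 Φ).memLp 2).norm)
        refine this.trans ?_
        simp only [Real.rpow_two, ← Real.sqrt_eq_rpow, SchwartzMap.integral_norm_sq_fourier]
        gcongr
        have := hG i
        simp only [hD]
        exact this
    _ = d * (Real.sqrt A * Real.sqrt B) := by simp

theorem lipschitz_normed_convolution {d : ℕ} (φ : ContDiffBump (0 : EuclideanSpace ℝ (Fin d)))
    (g : EuclideanSpace ℝ (Fin d) → ℝ) (hg : LipschitzWith 1 g) :
    LipschitzWith 1 (φ.normed volume ⋆[ContinuousLinearMap.lsmul ℝ ℝ, volume] g) := by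
  have hi : ∀ x, Integrable (fun t => φ.normed volume t • g (x - t)) := by
    intro x
    refine Continuous.integrable_of_hasCompactSupport ?_ ?_
    · exact φ.continuous_normed.smul (hg.continuous.comp (by fun_prop))
    · exact φ.hasCompactSupport_normed.smul_right
  refine LipschitzWith.of_le_add fun x y => ?_
  simp only [convolution_def, ContinuousLinearMap.lsmul_apply]
  have e : dist x y = ∫ t, φ.normed volume t • dist x y := by
    rw [integral_smul_const, φ.integral_normed, one_smul]
  rw [e, ← integral_add (hi y) ((φ.integrable_normed).smul_const _)]
  refine integral_mono (hi x) ((hi y).add ((φ.integrable_normed).smul_const _)) fun t => ?_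
  simp only [smul_eq_mul, ← mul_add]
  refine mul_le_mul_of_nonneg_left ?_ (φ.nonneg_normed t)
  have := hg.dist_le_mul (x - t) (y - t)
  rw [dist_sub_right, Real.dist_eq, NNReal.coe_one, one_mul] at this
  linarith [le_abs_self (g (x - t) - g (y - t))]

theorem lipschitz_compact_diff_le {d : ℕ} (μ ν : Measure (EuclideanSpace ℝ (Fin d)))
    [IsProbabilityMeasure μ] [IsProbabilityMeasure ν] (s : ℝ) (hs0 : 0 ≤ s)
    (hs : ∀ v : EuclideanSpace ℝ (Fin d),
      ‖∫ x, Complex.exp ((2 * Real.pi * ⟪v, x⟫ : ℝ) * Complex.I) ∂μ -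
        ∫ x, Complex.exp ((2 * Real.pi * ⟪v, x⟫ : ℝ) * Complex.I) ∂ν‖ ≤ 2 * Real.pi * ‖v‖ * s)
    (g : EuclideanSpace ℝ (Fin d) → ℝ) (hg : LipschitzWith 1 g) (R t : ℝ) (ht : 0 < t)
    (hsupp : Function.support g ⊆ Metric.closedBall 0 R) :
    ∫ x, g x ∂μ - ∫ x, g x ∂ν ≤ 8 * t + s * (d *
      (Real.sqrt (volume.real (Metric.closedBall (0 : EuclideanSpace ℝ (Fin d)) (R + 2 * t))) *
        Real.sqrt (1 / volume.real (Metric.closedBall (0 : EuclideanSpace ℝ (Fin d)) t)))) := by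
  let φ : ContDiffBump (0 : EuclideanSpace ℝ (Fin d)) := ⟨t, 2 * t, ht, by linarith⟩
  have hin : φ.rIn = t := rfl
  have hout : φ.rOut = 2 * t := rfl
  have hgc : HasCompactSupport g :=
    HasCompactSupport.of_support_subset_isCompact (isCompact_closedBall _ _) hsupp
  set g1 := (φ.normed volume ⋆[ContinuousLinearMap.lsmul ℝ ℝ, volume] g) with hg1
  have hg1l : LipschitzWith 1 g1 := lipschitz_normed_convolution φ g hg
  set g2 := (φ.normed volume ⋆[ContinuousLinearMap.lsmul ℝ ℝ, volume] g1) with hg2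
  have hg2l : LipschitzWith 1 g2 := lipschitz_normed_convolution φ g1 hg1l
  have hg1c : HasCompactSupport g1 := φ.hasCompactSupport_normed.convolution _ hgc
  have hg1s : ContDiff ℝ ∞ g1 :=
    φ.hasCompactSupport_normed.contDiff_convolution_left _ φ.contDiff_normed
      hg.continuous.locallyIntegrable
  have hg1supp : Function.support g1 ⊆ Metric.closedBall 0 (R + 2 * t) := by
    refine (support_convolution_subset _).trans ?_
    rw [φ.support_normed_eq, hout]
    rintro _ ⟨x, hx, y, hy, rfl⟩
    have h1 := hsupp hy
    simp only [Metric.mem_ball, dist_zero_right, Metric.mem_closedBall] at hx h1 ⊢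
    linarith [norm_add_le x y]
  have happ : ∀ k : EuclideanSpace ℝ (Fin d) → ℝ, LipschitzWith 1 k → ∀ x,
      dist ((φ.normed volume ⋆[ContinuousLinearMap.lsmul ℝ ℝ, volume] k) x) (k x) ≤ 2 * t := by
    intro k hk x
    refine φ.dist_normed_convolution_le hk.continuous.aestronglyMeasurable fun y hy => ?_
    have := hk.dist_le_mul y x
    rw [Metric.mem_ball, hout] at hy
    simp only [NNReal.coe_one, one_mul] at this
    linarith
  have hgg2 : ∀ x, |g2 x - g x| ≤ 4 * t := by
    intro x
    have h1 := happ g hg x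
    have h2 := happ g1 hg1l x
    have := dist_triangle (g2 x) (g1 x) (g x)
    rw [Real.dist_eq (g2 x) (g x)] at this
    linarith
  -- Schwartz versions
  let G : 𝓢(EuclideanSpace ℝ (Fin d), ℂ) :=
    (hg1c.comp_left (g := Complex.ofReal) Complex.ofReal_zero).toSchwartzMap
      (Complex.ofRealCLM.contDiff.comp hg1s)
  let Φ : 𝓢(EuclideanSpace ℝ (Fin d), ℂ) :=
    (φ.hasCompactSupport_normed.comp_left (g := Complex.ofReal) Complex.ofReal_zero).toSchwartzMap
      (Complex.ofRealCLM.contDiff.comp (φ.contDiff_normed (μ := volume)))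
  have hGa : ∀ x, G x = (g1 x : ℂ) := fun x => rfl
  have hΦa : ∀ x, Φ x = (φ.normed volume x : ℂ) := fun x => rfl
  let H : 𝓢(EuclideanSpace ℝ (Fin d), ℂ) :=
    SchwartzMap.convolution (ContinuousLinearMap.mul ℂ ℂ) Φ G
  have hHa : ∀ x, H x = (g2 x : ℂ) := by
    intro x
    rw [SchwartzMap.convolution_apply, hg2]
    simp only [convolution_def, ContinuousLinearMap.lsmul_apply, ContinuousLinearMap.mul_apply',
      hGa, hΦa, smul_eq_mul]
    rw [← integral_complex_ofReal]
    simp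
  have hFH : ∀ v, 𝓕 H v = 𝓕 Φ v * 𝓕 G v := by
    intro v
    rw [SchwartzMap.fourier_convolution]
    rfl
  have hGint : ∀ i : Fin d, ∫ x, ‖fderiv ℝ G x (EuclideanSpace.single i 1)‖ ^ 2 ≤
      volume.real (Metric.closedBall (0 : EuclideanSpace ℝ (Fin d)) (R + 2 * t)) := by
    intro i
    have hGl : LipschitzWith 1 G := by
      refine LipschitzWith.of_dist_le_mul fun x y => ?_
      rw [hGa, hGa, dist_eq_norm, ← Complex.ofReal_sub, Complex.norm_real, ← dist_eq_norm]
      exact hg1l.dist_le_mul x y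
    have hle : ∀ x, ‖fderiv ℝ G x (EuclideanSpace.single i 1)‖ ≤ 1 := by
      intro x
      refine (ContinuousLinearMap.le_opNorm _ _).trans ?_
      have := norm_fderiv_le_of_lipschitz ℝ (x₀ := x) hGl
      simpa using this
    have hz : ∀ x, x ∉ Metric.closedBall (0 : EuclideanSpace ℝ (Fin d)) (R + 2 * t) →
        fderiv ℝ G x = 0 := by
      intro x hx
      have h1 : tsupport G ⊆ Metric.closedBall 0 (R + 2 * t) := by
        refine closure_minimal (fun y hy => hg1supp ?_) Metric.isClosed_closedBall
        rw [Function.mem_support, hGa] at hy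
        simpa using hy
      exact Function.notMem_support.1 fun h => hx (h1 (support_fderiv_subset ℝ h))
    calc _ ≤ ∫ x, (Metric.closedBall (0 : EuclideanSpace ℝ (Fin d)) (R + 2 * t)).indicator
          (fun _ => (1:ℝ)) x := by
          refine integral_mono_of_nonneg (ae_of_all _ fun _ => by positivity) ?_
            (ae_of_all _ fun x => ?_)
          · exact (integrable_indicator_iff measurableSet_closedBall).2
              (integrableOn_const (measure_closedBall_lt_top).ne)
          · by_cases hx : x ∈ Metric.closedBall (0 : EuclideanSpace ℝ (Fin d)) (R + 2 * t)
            · simp only [Set.indicator_of_mem hx]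
              exact pow_le_one₀ (norm_nonneg _) (hle x)
            · simp [Set.indicator_of_notMem hx, hz x hx]
      _ = _ := by
          rw [integral_indicator measurableSet_closedBall, setIntegral_const]; simp
  have hΦint : ∫ x, ‖Φ x‖ ^ 2 ≤
      1 / volume.real (Metric.closedBall (0 : EuclideanSpace ℝ (Fin d)) t) := by
    calc _ ≤ ∫ x, (1 / volume.real (Metric.closedBall (0 : EuclideanSpace ℝ (Fin d)) t))
          * φ.normed volume x := by
          refine integral_mono_of_nonneg (ae_of_all _ fun _ => by positivity)
            (φ.integrable_normed.const_mul _) (ae_of_all _ fun x => ?_)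
          simp only [hΦa, Complex.norm_real, Real.norm_of_nonneg (φ.nonneg_normed x)]
          rw [sq]
          exact mul_le_mul_of_nonneg_right (φ.normed_le_div_measure_closedBall_rIn volume x)
            (φ.nonneg_normed x)
      _ = _ := by rw [integral_const_mul, φ.integral_normed, mul_one]
  have key := (schwartz_diff_le μ ν s hs H).trans (mul_le_mul_of_nonneg_left
    (by simp only [hFH]; exact fourier_cs G Φ _ _ hGint hΦint) hs0)
  simp only [hHa, integral_complex_ofReal, ← Complex.ofReal_sub, Complex.norm_real] at key
  have hgi : ∀ (ρ : Measure (EuclideanSpace ℝ (Fin d))) [IsProbabilityMeasure ρ],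
      |∫ x, g2 x ∂ρ - ∫ x, g x ∂ρ| ≤ 4 * t := by
    intro ρ _
    have i1 : Integrable g ρ := hg.continuous.integrable_of_hasCompactSupport hgc
    have i2 : Integrable g2 ρ := hg2l.continuous.integrable_of_hasCompactSupport
      (φ.hasCompactSupport_normed.convolution _ hg1c)
    rw [← integral_sub i2 i1, ← Real.norm_eq_abs]
    simpa using norm_integral_le_of_norm_le_const (μ := ρ) (f := fun x => g2 x - g x)
      (C := 4 * t) (ae_of_all _ hgg2)
  have k1 := abs_le.1 (hgi μ)
  have k2 := abs_le.1 (hgi ν)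
  have k3 := (le_abs_self _).trans key
  linarith

theorem tail_le {d : ℕ} (μ : Measure (EuclideanSpace ℝ (Fin d))) [IsProbabilityMeasure μ]
    (q b : ℝ) (hq : 1 < q) (hb : 0 ≤ b)
    (h : ∫⁻ x, (‖x‖₊ : ℝ≥0∞) ^ q ∂μ ≤ ENNReal.ofReal (b ^ q)) (R : ℝ) (hR : 0 < R)
    (k : EuclideanSpace ℝ (Fin d) → ℝ)
    (hk1 : ∀ x, ‖x‖ ≤ R → k x = 0) (hk2 : ∀ x, |k x| ≤ ‖x‖) :
    |∫ x, k x ∂μ| ≤ b ^ q / R ^ (q - 1) := by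
  have hconv : ∀ x : EuclideanSpace ℝ (Fin d), ENNReal.ofReal (‖x‖ ^ q) = (‖x‖₊ : ℝ≥0∞) ^ q := by
    intro x
    rw [← ENNReal.ofReal_rpow_of_nonneg (norm_nonneg _) (by linarith), ofReal_norm]; rfl
  have hle : ∀ x, ‖k x‖ ≤ ‖x‖ ^ q / R ^ (q - 1) := by
    intro x
    rcases le_or_gt ‖x‖ R with hx | hx
    · rw [hk1 x hx, norm_zero]; positivity
    · refine (hk2 x).trans ?_
      rw [le_div_iff₀ (by positivity)]
      have hx0 : 0 < ‖x‖ := hR.trans hx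
      calc ‖x‖ * R ^ (q - 1) ≤ ‖x‖ * ‖x‖ ^ (q - 1) := by
            gcongr
        _ = ‖x‖ ^ q := by
            rw [← Real.rpow_one_add' hx0.le (by linarith)]; congr 1; ring
  have hm : Measurable (fun x : EuclideanSpace ℝ (Fin d) => ‖x‖ ^ q) := by fun_prop
  have hint : Integrable (fun x : EuclideanSpace ℝ (Fin d) => ‖x‖ ^ q) μ := by
    refine ⟨hm.aestronglyMeasurable, ?_⟩
    rw [hasFiniteIntegral_iff_ofReal (ae_of_all _ fun x => by positivity)]
    simp only [hconv]
    exact h.trans_lt ENNReal.ofReal_lt_top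
  have hI : ∫ x, ‖x‖ ^ q ∂μ ≤ b ^ q := by
    rw [integral_eq_lintegral_of_nonneg_ae (ae_of_all _ fun x => by positivity)
      hm.aestronglyMeasurable]
    refine ENNReal.toReal_le_of_le_ofReal (by positivity) ?_
    simp only [hconv]
    exact h
  rw [← Real.norm_eq_abs]
  refine (norm_integral_le_of_norm_le (hint.div_const _) (ae_of_all _ hle)).trans ?_
  rw [integral_div]
  gcongr

theorem lipschitz_diff_le {d : ℕ} (μ ν : Measure (EuclideanSpace ℝ (Fin d)))
    [IsProbabilityMeasure μ] [IsProbabilityMeasure ν] (q b : ℝ) (hq : 1 < q) (hb : 0 ≤ b)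
    (hμ : ∫⁻ x, (‖x‖₊ : ℝ≥0∞) ^ q ∂μ ≤ ENNReal.ofReal (b ^ q))
    (hν : ∫⁻ x, (‖x‖₊ : ℝ≥0∞) ^ q ∂ν ≤ ENNReal.ofReal (b ^ q))
    (hμ1 : Integrable (fun x => x) μ) (hν1 : Integrable (fun x => x) ν)
    (s : ℝ) (hs0 : 0 ≤ s)
    (hs : ∀ v : EuclideanSpace ℝ (Fin d),
      ‖∫ x, Complex.exp ((2 * Real.pi * ⟪v, x⟫ : ℝ) * Complex.I) ∂μ -
        ∫ x, Complex.exp ((2 * Real.pi * ⟪v, x⟫ : ℝ) * Complex.I) ∂ν‖ ≤ 2 * Real.pi * ‖v‖ * s)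
    (f : EuclideanSpace ℝ (Fin d) → ℝ) (hf : LipschitzWith 1 f) (R t : ℝ) (ht : 0 < t)
    (hR : 0 < R) :
    ∫ x, f x ∂μ - ∫ x, f x ∂ν ≤ 2 * (b ^ q / R ^ (q - 1)) + 8 * t +
      s * (d * Real.sqrt (((2 * R + 2 * t) / t) ^ d)) := by
  let f0 : EuclideanSpace ℝ (Fin d) → ℝ := fun x => f x - f 0
  have hf0 : LipschitzWith 1 f0 := by
    refine LipschitzWith.of_dist_le_mul fun x y => ?_
    simpa [f0] using hf.dist_le_mul x y
  have hf0n : ∀ x, |f0 x| ≤ ‖x‖ := by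
    intro x
    simpa [f0, Real.dist_eq] using hf.dist_le_mul x 0
  let c : EuclideanSpace ℝ (Fin d) → ℝ := fun x => max (2 * R - ‖x‖) 0
  have hc : LipschitzWith 1 c := by
    refine LipschitzWith.max_const ?_ 0
    refine LipschitzWith.of_le_add fun x y => ?_
    have := norm_le_norm_add_norm_sub' y x
    rw [dist_eq_norm]
    have h2 := norm_sub_rev x y
    linarith
  have hc0 : ∀ x, 0 ≤ c x := fun x => le_max_right _ _
  let g : EuclideanSpace ℝ (Fin d) → ℝ := fun x => max (min (f0 x) (c x)) (-(c x))
  have hg : LipschitzWith 1 g := by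
    have := (hf0.min hc).max hc.neg
    simpa using this
  have hsupp : Function.support g ⊆ Metric.closedBall 0 (2 * R) := by
    intro x hx
    by_contra hcon
    simp only [Metric.mem_closedBall, dist_zero_right, not_le] at hcon
    have : c x = 0 := max_eq_right (by linarith)
    apply hx
    simp [g, this]
  have hk1 : ∀ x, ‖x‖ ≤ R → f0 x - g x = 0 := by
    intro x hx
    have h1 := abs_le.1 (hf0n x)
    have h2 : R ≤ c x := le_trans (by linarith) (le_max_left _ _)
    have : g x = f0 x := by
      simp only [g]
      rw [min_eq_left (by linarith), max_eq_left (by linarith)]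
    rw [this, sub_self]
  have hk2 : ∀ x, |f0 x - g x| ≤ ‖x‖ := by
    intro x
    refine le_trans ?_ (hf0n x)
    have h0 := hc0 x
    simp only [g]
    rcases le_total (f0 x) (c x) with h1 | h1
    · rw [min_eq_left h1]
      rcases le_total (f0 x) (-(c x)) with h2 | h2
      · rw [max_eq_right h2, abs_of_nonpos (by linarith), abs_of_nonpos (by linarith)]; linarith
      · rw [max_eq_left h2]; simp
    · rw [min_eq_right h1, max_eq_left (by linarith), abs_of_nonneg (by linarith),
        abs_of_nonneg (by linarith)]
      linarith
  have hgc : HasCompactSupport g :=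
    HasCompactSupport.of_support_subset_isCompact (isCompact_closedBall _ _) hsupp
  have hfi : ∀ (ρ : Measure (EuclideanSpace ℝ (Fin d))) [IsProbabilityMeasure ρ],
      Integrable (fun x => x) ρ → Integrable f0 ρ := by
    intro ρ _ hρ
    exact Integrable.mono' hρ.norm hf0.continuous.aestronglyMeasurable (ae_of_all _ hf0n)
  have hgi : ∀ (ρ : Measure (EuclideanSpace ℝ (Fin d))) [IsProbabilityMeasure ρ],
      Integrable g ρ := fun ρ _ => hg.continuous.integrable_of_hasCompactSupport hgc
  have hff : ∀ (ρ : Measure (EuclideanSpace ℝ (Fin d))) [IsProbabilityMeasure ρ],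
      Integrable (fun x => x) ρ → ∫ x, f x ∂ρ = ∫ x, f0 x ∂ρ + f 0 := by
    intro ρ _ hρ
    have : ∀ x, f x = f0 x + f 0 := fun x => by simp [f0]
    rw [integral_congr_ae (ae_of_all _ this), integral_add (hfi ρ hρ) (integrable_const _)]
    simp
  have t1 := tail_le μ q b hq hb hμ R hR _ hk1 hk2
  have t2 := tail_le ν q b hq hb hν R hR _ hk1 hk2
  rw [integral_sub (hfi μ hμ1) (hgi μ)] at t1
  rw [integral_sub (hfi ν hν1) (hgi ν)] at t2
  have main := lipschitz_compact_diff_le μ ν s hs0 hs g hg (2 * R) t ht hsupp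
  have hvol : Real.sqrt (volume.real (Metric.closedBall (0 : EuclideanSpace ℝ (Fin d)) (2 * R + 2 * t))) *
        Real.sqrt (1 / volume.real (Metric.closedBall (0 : EuclideanSpace ℝ (Fin d)) t))
        = Real.sqrt (((2 * R + 2 * t) / t) ^ d) := by
    rw [← Real.sqrt_mul measureReal_nonneg, Measure.addHaar_real_closedBall' _ _ (by positivity),
      Measure.addHaar_real_closedBall' _ _ ht.le]
    have hV : 0 < volume.real (Metric.closedBall (0 : EuclideanSpace ℝ (Fin d)) 1) :=
      ENNReal.toReal_pos (Metric.measure_closedBall_pos _ _ one_pos).ne' measure_closedBall_lt_top.ne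
    congr 1
    rw [finrank_euclideanSpace_fin, div_pow]
    field_simp
  rw [hvol] at main
  rw [hff μ hμ1, hff ν hν1]
  have u1 := abs_le.1 t1
  have u2 := abs_le.1 t2
  linarith

theorem numeric_bound (d : ℕ) (q b r s : ℝ) (hq : 1 < q) (hb : 0 < b) (hr : 0 < r) (hr1 : r ≤ 1)
    (hs0 : 0 ≤ s) (hs : s ≤ b * (r / 16) ^ (1 + (q / (q - 1)) * d / 2)) :
    2 * (b ^ q / (b * r ^ (-(1 / (q - 1)))) ^ (q - 1)) + 8 * (b * r) +
      s * (d * Real.sqrt (((2 * (b * r ^ (-(1 / (q - 1)))) + 2 * (b * r)) / (b * r)) ^ d))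
      ≤ 11 * b * r := by
  have hq1 : 0 < q - 1 := by linarith
  set p := q / (q - 1) with hp
  have hp1 : 1 ≤ p := by rw [hp, le_div_iff₀ hq1]; linarith
  have e1 : b ^ q / (b * r ^ (-(1 / (q - 1)))) ^ (q - 1) = b * r := by
    rw [Real.mul_rpow hb.le (by positivity), ← Real.rpow_mul hr.le]
    have : -(1 / (q - 1)) * (q - 1) = -1 := by field_simp
    rw [this, Real.rpow_neg_one, div_eq_iff (by positivity)]
    have : b ^ q = b * b ^ (q - 1) := by
      rw [← Real.rpow_one_add' hb.le (by linarith)]; congr 1; ring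
    rw [this]; field_simp
  have e2 : (2 * (b * r ^ (-(1 / (q - 1)))) + 2 * (b * r)) / (b * r) ≤ 4 * r ^ (-p) := by
    have h1 : r ^ (-p) = r ^ (-(1 / (q - 1))) / r := by
      rw [← Real.rpow_sub_one hr.ne']
      congr 1; rw [hp]; field_simp; ring
    have h2 : 1 ≤ r ^ (-(1 / (q - 1))) :=
      Real.one_le_rpow_of_pos_of_le_one_of_nonpos hr hr1 (by
        have : 0 < 1 / (q - 1) := by positivity
        linarith)
    rw [h1, div_le_iff₀ (by positivity)]
    have : 4 * (r ^ (-(1 / (q - 1))) / r) * (b * r) = 4 * b * r ^ (-(1 / (q - 1))) := by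
      field_simp
    rw [this]
    nlinarith
  have e3 : Real.sqrt (((2 * (b * r ^ (-(1 / (q - 1)))) + 2 * (b * r)) / (b * r)) ^ d)
      ≤ 2 ^ d * r ^ (-(p * d / 2)) := by
    refine Real.sqrt_le_iff.2 ⟨by positivity, ?_⟩
    refine (pow_le_pow_left₀ (by positivity) e2 d).trans (le_of_eq ?_)
    have : (r ^ (-(p * d / 2))) ^ 2 = (r ^ (-p)) ^ d := by
      rw [← Real.rpow_natCast, ← Real.rpow_natCast, ← Real.rpow_mul hr.le, ← Real.rpow_mul hr.le]
      congr 1; push_cast; ring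
    rw [mul_pow, mul_pow, this, ← pow_mul, mul_comm d 2, pow_mul]
    norm_num
  have e4 : (d : ℝ) ≤ 2 ^ d := by exact_mod_cast (Nat.lt_two_pow_self).le
  have e5 : (r / 16) ^ (1 + p * d / 2) * r ^ (-(p * d / 2)) * 4 ^ d ≤ r := by
    have h16 : (4 : ℝ) ^ d ≤ 16 ^ (p * d / 2) := by
      have : (16 : ℝ) ^ (p * d / 2) = 4 ^ (p * d) := by
        rw [show (16 : ℝ) = 4 ^ (2 : ℝ) by norm_num, ← Real.rpow_mul (by norm_num)]
        congr 1; ring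
      rw [this, ← Real.rpow_natCast]
      refine Real.rpow_le_rpow_of_exponent_le (by norm_num) ?_
      nlinarith [(Nat.cast_nonneg d : (0:ℝ) ≤ d)]
    rw [Real.rpow_add (by positivity), Real.rpow_one, Real.div_rpow hr.le (by norm_num),
      Real.rpow_neg hr.le]
    have hr' : 0 < r ^ (p * d / 2) := by positivity
    have h16' : (0:ℝ) < 16 ^ (p * d / 2) := by positivity
    have : r / 16 * (r ^ (p * d / 2) / 16 ^ (p * d / 2)) * (r ^ (p * d / 2))⁻¹ * 4 ^ d
      = r / 16 * (4 ^ d / 16 ^ (p * d / 2)) := by field_simp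
    rw [this]
    have h3 : (4 : ℝ) ^ d / 16 ^ (p * d / 2) ≤ 1 := (div_le_one h16').2 h16
    nlinarith
  have e6 : s * (d * Real.sqrt (((2 * (b * r ^ (-(1 / (q - 1)))) + 2 * (b * r)) / (b * r)) ^ d))
      ≤ b * r := by
    calc _ ≤ (b * (r / 16) ^ (1 + p * d / 2)) * (2 ^ d * (2 ^ d * r ^ (-(p * d / 2)))) := by
          gcongr
      _ = b * ((r / 16) ^ (1 + p * d / 2) * r ^ (-(p * d / 2)) * 4 ^ d) := by
          rw [show (4 : ℝ) = 2 * 2 by norm_num, mul_pow]; ring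
      _ ≤ b * r := by gcongr
  rw [e1]
  linarith


theorem hs_bound {d : ℕ} (μ ν : Measure (EuclideanSpace ℝ (Fin d)))
    [IsProbabilityMeasure μ] [IsProbabilityMeasure ν] (b : ℝ) (hb : 0 ≤ b)
    (h1 : ∫⁻ x, (‖x‖₊ : ℝ≥0∞) ∂μ ≤ ENNReal.ofReal b)
    (h2 : ∫⁻ x, (‖x‖₊ : ℝ≥0∞) ∂ν ≤ ENNReal.ofReal b) (s : ℝ)
    (hsup : ∀ θ : EuclideanSpace ℝ (Fin d), ‖θ‖ = 1 →
      kantorovichW (μ.map (fun x => ⟪x, θ⟫)) (ν.map (fun x => ⟪x, θ⟫)) ≤ s)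
    (v : EuclideanSpace ℝ (Fin d)) :
    ‖∫ x, Complex.exp ((2 * Real.pi * ⟪v, x⟫ : ℝ) * Complex.I) ∂μ -
        ∫ x, Complex.exp ((2 * Real.pi * ⟪v, x⟫ : ℝ) * Complex.I) ∂ν‖
      ≤ 2 * Real.pi * ‖v‖ * s := by
  by_cases hv : v = 0
  · subst hv
    simp
  have hv0 : 0 < ‖v‖ := norm_pos_iff.2 hv
  set θ : EuclideanSpace ℝ (Fin d) := ‖v‖⁻¹ • v with hθd
  have hθ : ‖θ‖ = 1 := by
    rw [hθd, norm_smul, norm_inv, norm_norm, inv_mul_cancel₀ hv0.ne']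
  have hin : ∀ x, 2 * Real.pi * ⟪v, x⟫ = 2 * Real.pi * ‖v‖ * ⟪x, θ⟫ := by
    intro x
    rw [hθd, inner_smul_right, real_inner_comm x v]
    field_simp
  have hmeas : Measurable (fun x : EuclideanSpace ℝ (Fin d) => ⟪x, θ⟫) := by fun_prop
  haveI : IsProbabilityMeasure (μ.map (fun x => ⟪x, θ⟫)) :=
    Measure.isProbabilityMeasure_map hmeas.aemeasurable
  haveI : IsProbabilityMeasure (ν.map (fun x => ⟪x, θ⟫)) :=
    Measure.isProbabilityMeasure_map hmeas.aemeasurable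
  have key := norm_charFun_sub_le (μ.map (fun x => ⟪x, θ⟫)) (ν.map (fun x => ⟪x, θ⟫))
    (ne_top_of_le_ne_top ENNReal.ofReal_ne_top
      (infCost_le _ _ b hb ((lintegral_proj_le μ θ hθ).trans h1)
        ((lintegral_proj_le ν θ hθ).trans h2))) (2 * Real.pi * ‖v‖)
  rw [integral_map hmeas.aemeasurable
      (Continuous.aestronglyMeasurable (by fun_prop)),
    integral_map hmeas.aemeasurable
      (Continuous.aestronglyMeasurable (by fun_prop))] at key
  have hpos : 0 ≤ 2 * Real.pi * ‖v‖ := by positivity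
  rw [abs_of_nonneg hpos] at key
  simp_rw [hin]
  exact key.trans (mul_le_mul_of_nonneg_left (hsup θ hθ) hpos)

theorem W_le_of_r {d : ℕ} (μ ν : Measure (EuclideanSpace ℝ (Fin d)))
    [IsProbabilityMeasure μ] [IsProbabilityMeasure ν] (q b : ℝ) (hq : 1 < q) (hb : 0 < b)
    (hμ : ∫⁻ x, (‖x‖₊ : ℝ≥0∞) ^ q ∂μ ≤ ENNReal.ofReal (b ^ q))
    (hν : ∫⁻ x, (‖x‖₊ : ℝ≥0∞) ^ q ∂ν ≤ ENNReal.ofReal (b ^ q))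
    (s : ℝ) (hs0 : 0 ≤ s)
    (hsup : ∀ θ : EuclideanSpace ℝ (Fin d), ‖θ‖ = 1 →
      kantorovichW (μ.map (fun x => ⟪x, θ⟫)) (ν.map (fun x => ⟪x, θ⟫)) ≤ s)
    (r : ℝ) (hr : 0 < r) (hs : s ≤ b * (r / 16) ^ (1 + (q / (q - 1)) * d / 2)) :
    kantorovichW μ ν ≤ 11 * b * r := by
  have h1 := lintegral_nnnorm_le μ q b hq hb.le hμ
  have h2 := lintegral_nnnorm_le ν q b hq hb.le hν
  have i1 : Integrable (fun x : EuclideanSpace ℝ (Fin d) => x) μ :=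
    ⟨aestronglyMeasurable_id, lt_of_le_of_lt h1 ENNReal.ofReal_lt_top⟩
  have i2 : Integrable (fun x : EuclideanSpace ℝ (Fin d) => x) ν :=
    ⟨aestronglyMeasurable_id, lt_of_le_of_lt h2 ENNReal.ofReal_lt_top⟩
  rcases le_total r 1 with hr1 | hr1
  · refine kantorovich_duality μ ν i1 i2 _ fun f hf => ?_
    refine le_trans ?_ (numeric_bound d q b r s hq hb hr hr1 hs0 hs)
    refine lipschitz_diff_le μ ν q b hq hb.le hμ hν i1 i2 s hs0
      (hs_bound μ ν b hb.le h1 h2 s hsup) f hf _ _ ?_ ?_ <;> positivity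
  · have := kantorovichW_le μ ν b hb.le h1 h2
    nlinarith

/-- **Quantitative Cramér–Wold theorem for the Kantorovich distance** (Theorem 1.1).
If `μ, ν` are probability measures on `ℝ^d` with `∫ |x|^q dμ, ∫ |x|^q dν ≤ b^q` for some
`q > 1`, `b ≥ 0`, then `W(μ,ν) ≤ c b^{1-β} (sup_{|θ|=1} W(μ_θ,ν_θ))^β` with
`β = 2 / (2 + d q / (q - 1))`, for an absolute constant `c > 0`. -/
theorem cramer_wold_kantorovich :
    ∃ c : ℝ, 0 < c ∧ ∀ (d : ℕ) (q b : ℝ), 1 < q → 0 ≤ b →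
    ∀ (μ ν : Measure (EuclideanSpace ℝ (Fin d))),
      IsProbabilityMeasure μ → IsProbabilityMeasure ν →
      (∫⁻ x, (‖x‖₊ : ℝ≥0∞) ^ q ∂μ ≤ ENNReal.ofReal (b ^ q)) →
      (∫⁻ x, (‖x‖₊ : ℝ≥0∞) ^ q ∂ν ≤ ENNReal.ofReal (b ^ q)) →
      kantorovichW μ ν ≤
        c * b ^ (1 - 2 / (2 + (d : ℝ) * q / (q - 1))) *
          (⨆ θ : Metric.sphere (0 : EuclideanSpace ℝ (Fin d)) 1,
            kantorovichW (μ.map (fun x => ⟪x, (θ : EuclideanSpace ℝ (Fin d))⟫))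
              (ν.map (fun x => ⟪x, (θ : EuclideanSpace ℝ (Fin d))⟫))) ^
          (2 / (2 + (d : ℝ) * q / (q - 1))) := by
  refine ⟨176, by norm_num, ?_⟩
  intro d q b hq hb μ ν hμp hνp hμ hν
  have h1 := lintegral_nnnorm_le μ q b hq hb hμ
  have h2 := lintegral_nnnorm_le ν q b hq hb hν
  set S : Metric.sphere (0 : EuclideanSpace ℝ (Fin d)) 1 → ℝ := fun θ =>
    kantorovichW (μ.map (fun x => ⟪x, (θ : EuclideanSpace ℝ (Fin d))⟫))
              (ν.map (fun x => ⟪x, (θ : EuclideanSpace ℝ (Fin d))⟫)) with hS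
  have hs0 : 0 ≤ ⨆ θ, S θ := Real.iSup_nonneg fun θ => kantorovichW_nonneg _ _
  have hle : ∀ θ, S θ ≤ 2 * b := by
    intro θ
    have hθ : ‖(θ : EuclideanSpace ℝ (Fin d))‖ = 1 := by simp
    have hmeas : Measurable (fun x : EuclideanSpace ℝ (Fin d) =>
      ⟪x, (θ : EuclideanSpace ℝ (Fin d))⟫) := by fun_prop
    haveI : IsProbabilityMeasure (μ.map (fun x => ⟪x, (θ : EuclideanSpace ℝ (Fin d))⟫)) :=
      Measure.isProbabilityMeasure_map hmeas.aemeasurable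
    haveI : IsProbabilityMeasure (ν.map (fun x => ⟪x, (θ : EuclideanSpace ℝ (Fin d))⟫)) :=
      Measure.isProbabilityMeasure_map hmeas.aemeasurable
    exact kantorovichW_le _ _ b hb ((lintegral_proj_le μ _ hθ).trans h1)
        ((lintegral_proj_le ν _ hθ).trans h2)
  have hbdd : BddAbove (Set.range S) := ⟨2 * b, by rintro _ ⟨θ, rfl⟩; exact hle θ⟩
  have hsup : ∀ θ : EuclideanSpace ℝ (Fin d), ‖θ‖ = 1 →
      kantorovichW (μ.map (fun x => ⟪x, θ⟫)) (ν.map (fun x => ⟪x, θ⟫)) ≤ ⨆ θ, S θ := by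
    intro θ hθ
    exact le_ciSup hbdd (⟨θ, by simpa using hθ⟩ : Metric.sphere (0 : EuclideanSpace ℝ (Fin d)) 1)
  generalize (⨆ θ, S θ) = s at hs0 hsup ⊢
  have hq1 : 0 < q - 1 := by linarith
  set β : ℝ := 2 / (2 + (d : ℝ) * q / (q - 1)) with hβ
  have hden : 0 < 2 + (d : ℝ) * q / (q - 1) := by
    have : 0 ≤ (d : ℝ) * q / (q - 1) := by positivity
    linarith
  have hβ0 : 0 < β := by positivity
  have hβi : 1 + (q / (q - 1)) * d / 2 = β⁻¹ := by
    rw [hβ, inv_div]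
    field_simp
  rcases hb.eq_or_lt with hb0 | hbpos
  · have hW := kantorovichW_le μ ν b hb h1 h2
    rw [← hb0, mul_zero] at hW
    refine hW.trans ?_
    positivity
  have hmain : ∀ r, 16 * (s / b) ^ β < r → kantorovichW μ ν ≤ 11 * b * r := by
    intro r hr
    have hsb : 0 ≤ s / b := by positivity
    have hx : 0 ≤ (s / b) ^ β := by positivity
    have hr0 : 0 < r := by linarith
    refine W_le_of_r μ ν q b hq hbpos hμ hν s hs0 hsup r hr0 ?_
    rw [hβi]
    have h3 : (s / b) ^ β ≤ r / 16 := by linarith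
    have h4 := Real.rpow_le_rpow hx h3 (inv_nonneg.2 hβ0.le)
    rw [Real.rpow_rpow_inv hsb hβ0.ne'] at h4
    rw [div_le_iff₀ hbpos] at h4
    linarith
  have hfin : kantorovichW μ ν ≤ 11 * b * (16 * (s / b) ^ β) := by
    refine le_of_forall_pos_le_add fun ε hε => ?_
    have := hmain (16 * (s / b) ^ β + ε / (11 * b)) (by
      have : 0 < ε / (11 * b) := by positivity
      linarith)
    refine this.trans (le_of_eq ?_)
    field_simp
  refine hfin.trans (le_of_eq ?_)
  rw [Real.div_rpow hs0 hb, Real.rpow_sub hbpos, Real.rpow_one]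
  ring
end
end
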